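/- There exist β₀ > 0 and a function ε(β) with ε(β) → 0 as β → ∞ such that for every β ≥ β₀ the following holds: for every finite V ⊂ ℤ² with 0 ∈ V, every integer h ≥ 1 and every integer r ≥ 1, π_V(η_0 = h) ≤ e^{−(3/4)βr} · π_V(η_0 = h−1) + e^{ε(β)·r} · π_{B_r}(η_0 = h). -/

import Mathlib

open Filter Topology Classical

noncomputable section

abbrev Site : Type := ℤ × ℤ

/-- Nearest-neighbor adjacency in `ℤ²`. -/
def adjP (x y : Site) : Prop := |x.1 - y.1| + |x.2 - y.2| = 1

/-- The Discrete Gaussian Hamiltonian `H(η) = ∑_{x∼y} (η_x - η_y)²`, the sum running over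
unordered nearest-neighbor pairs (each ordered pair is counted once, whence the factor 1/2). -/
def dgH (η : Site → ℤ) : ℝ :=
  (1 / 2) * ∑' p : Site × Site, if adjP p.1 p.2 then ((η p.1 - η p.2 : ℤ) : ℝ) ^ 2 else 0

/-- Unnormalized weight of the event `A` for the DG model on `Λ` with zero boundary conditions. -/
def dgW (β : ℝ) (Λ : Finset Site) (A : (Site → ℤ) → Prop) : ℝ :=
  ∑' η : Site → ℤ, if (∀ x ∉ Λ, η x = 0) ∧ A η then Real.exp (-β * dgH η) else 0

/-- `π_Λ(A)`: probability of the event `A` under the DG measure on `Λ`. -/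
def dgProb (β : ℝ) (Λ : Finset Site) (A : (Site → ℤ) → Prop) : ℝ :=
  dgW β Λ A / dgW β Λ (fun _ => True)

/-- `ϖ_Λ(A)`: DG measure conditioned on the floor event `η ≥ 0`. -/
def dgProbFloor (β : ℝ) (Λ : Finset Site) (A : (Site → ℤ) → Prop) : ℝ :=
  dgW β Λ (fun η => A η ∧ ∀ x, 0 ≤ η x) / dgW β Λ (fun η => ∀ x, 0 ≤ η x)

/-- The box `Λ_L = {1,…,L}²`. -/
def box (L : ℕ) : Finset Site := Finset.Icc (1 : ℤ) (L : ℤ) ×ˢ Finset.Icc (1 : ℤ) (L : ℤ)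

/-- The lattice ball `B_r = {x ∈ ℤ² : |x| ≤ r}`. -/
def ball (r : ℝ) : Finset Site :=
  ((Finset.Icc (-⌈r⌉) ⌈r⌉) ×ˢ (Finset.Icc (-⌈r⌉) ⌈r⌉)).filter
    fun x => ((x.1 : ℝ) ^ 2 + (x.2 : ℝ) ^ 2 ≤ r ^ 2)


abbrev Edge : Type := (ℤ × ℤ) × Bool

def src (e : Edge) : Site := e.1
def dst (e : Edge) : Site := if e.2 then (e.1.1, e.1.2 + 1) else (e.1.1 + 1, e.1.2)

def edg (D : Finset Site) : Finset Edge :=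
  D ×ˢ (Finset.univ : Finset Bool) ∪ (D.image fun x => (((x.1 - 1, x.2), false) : Edge)) ∪
    (D.image fun x => (((x.1, x.2 - 1), true) : Edge))

lemma mem_edg {D : Finset Site} {e : Edge} : e ∈ edg D ↔ src e ∈ D ∨ dst e ∈ D := by
  obtain ⟨⟨a, b⟩, d⟩ := e
  simp only [edg, Finset.mem_union, Finset.mem_product, Finset.mem_univ, and_true,
    Finset.mem_image, src, dst]
  constructor
  · rintro ((h | ⟨x, hx, h⟩) | ⟨x, hx, h⟩)
    · exact Or.inl h
    · right
      simp only [Prod.mk.injEq] at h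
      obtain ⟨⟨h1, h2⟩, h3⟩ := h
      subst h1 h2 h3
      simpa using hx
    · right
      simp only [Prod.mk.injEq] at h
      obtain ⟨⟨h1, h2⟩, h3⟩ := h
      subst h1 h2 h3
      simpa using hx
  · rintro (h | h)
    · exact Or.inl (Or.inl h)
    · cases d
      · exact Or.inl (Or.inr ⟨_, h, by simp⟩)
      · exact Or.inr ⟨_, h, by simp⟩

lemma adjP_symm {x y : Site} (h : adjP x y) : adjP y x := by
  unfold adjP at *
  rw [abs_sub_comm y.1, abs_sub_comm y.2]; exact h

lemma adj_edge (e : Edge) : adjP (src e) (dst e) := by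
  obtain ⟨⟨a, b⟩, d⟩ := e
  cases d <;> simp [adjP, src, dst]

lemma adj_cases {x y : Site} (h : adjP x y) :
    (∃ e : Edge, src e = x ∧ dst e = y) ∨ (∃ e : Edge, src e = y ∧ dst e = x) := by
  obtain ⟨a, b⟩ := x
  obtain ⟨c, d⟩ := y
  simp only [adjP] at h
  have : (c = a + 1 ∧ d = b) ∨ (c = a ∧ d = b + 1) ∨ (a = c + 1 ∧ d = b) ∨ (a = c ∧ b = d + 1) := by
    rcases abs_cases (a - c) with h1 | h1 <;> rcases abs_cases (b - d) with h2 | h2 <;> omega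
  rcases this with ⟨h1, h2⟩ | ⟨h1, h2⟩ | ⟨h1, h2⟩ | ⟨h1, h2⟩
  · left; exact ⟨((a, b), false), by simp [src], by simp [dst, h1, h2]⟩
  · left; exact ⟨((a, b), true), by simp [src], by simp [dst, h1, h2]⟩
  · right; exact ⟨((c, d), false), by simp [src], by simp [dst, h1, h2]⟩
  · right; exact ⟨((c, d), true), by simp [src], by simp [dst, h1, h2]⟩

def phi (q : Edge × Bool) : Site × Site := if q.2 then (dst q.1, src q.1) else (src q.1, dst q.1)

lemma phi_inj : Function.Injective phi := by
  rintro ⟨⟨⟨a, b⟩, d⟩, s⟩ ⟨⟨⟨a', b'⟩, d'⟩, s'⟩ h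
  cases d <;> cases d' <;> cases s <;> cases s' <;> simp [phi, src, dst] at h ⊢ <;> omega

def InD (D : Finset Site) (η : Site → ℤ) : Prop := ∀ x ∉ D, η x = 0

lemma dgH_eq {D : Finset Site} {η : Site → ℤ} (hη : InD D η) :
    dgH η = ∑ e ∈ edg D, ((η (src e) - η (dst e) : ℤ) : ℝ) ^ 2 := by
  unfold dgH
  have h1 : ∑' p : Site × Site, (if adjP p.1 p.2 then ((η p.1 - η p.2 : ℤ) : ℝ) ^ 2 else 0)
      = ∑' q : Edge × Bool, ((η (src q.1) - η (dst q.1) : ℤ) : ℝ) ^ 2 := by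
    rw [← phi_inj.tsum_eq]
    · apply tsum_congr
      rintro ⟨e, s⟩
      cases s
      · simp [phi, adj_edge]
      · simp only [phi, if_true, adjP_symm (adj_edge e)]
        push_cast; ring
    · rintro ⟨x, y⟩ hp
      simp only [Function.mem_support, ne_eq, ite_eq_right_iff, not_forall] at hp
      obtain ⟨ha, -⟩ := hp
      rcases adj_cases ha with ⟨e, h1, h2⟩ | ⟨e, h1, h2⟩
      · exact ⟨(e, false), by simp [phi, h1, h2]⟩
      · exact ⟨(e, true), by simp [phi, h1, h2]⟩
  rw [h1, tsum_eq_sum (s := edg D ×ˢ Finset.univ)]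
  · rw [Finset.sum_product]
    simp only [Finset.sum_const, Finset.card_univ, Fintype.card_bool]
    rw [← Finset.smul_sum]; simp
  · rintro ⟨e, s⟩ h
    simp only [Finset.mem_product, Finset.mem_univ, and_true, mem_edg, not_or] at h
    simp [hη _ h.1, hη _ h.2]

def bd (K : Finset Site) : Finset Edge := (edg K).filter fun e => ¬ (src e ∈ K ↔ dst e ∈ K)

lemma mem_bd {K : Finset Site} {e : Edge} : e ∈ bd K ↔ ¬ (src e ∈ K ↔ dst e ∈ K) := by
  simp only [bd, Finset.mem_filter, mem_edg]
  tauto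

lemma dgH_neg (η : Site → ℤ) : dgH (-η) = dgH η := by
  unfold dgH
  congr 1
  apply tsum_congr
  intro p
  split_ifs
  · simp only [Pi.neg_apply]; push_cast; ring
  · rfl

def low (A : Finset Site) (η : Site → ℤ) : Site → ℤ := fun x => η x - if x ∈ A then 1 else 0

lemma low_inj (A : Finset Site) : Function.Injective (low A) := by
  intro η η' h
  funext x
  have := congrFun h x
  simpa [low] using this

/-- boundary condition of a set to be lowered -/
def BC (A : Finset Site) (η : Site → ℤ) : Prop :=
  ∀ x y, x ∈ A → y ∉ A → adjP x y → 1 ≤ η x ∧ η y ≤ 0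

lemma low_InD {A D : Finset Site} {η : Site → ℤ} (hA : A ⊆ D) (h : InD D η) : InD D (low A η) := by
  intro x hx
  have : x ∉ A := fun h => hx (hA h)
  simp [low, this, h x hx]

lemma dgH_low {A D : Finset Site} {η : Site → ℤ} (hA : A ⊆ D) (h : InD D η) (hb : BC A η) :
    dgH (low A η) + (bd A).card ≤ dgH η := by
  rw [dgH_eq h, dgH_eq (low_InD hA h)]
  have hsub : bd A ⊆ edg D := by
    intro e he
    rw [mem_bd] at he
    rw [mem_edg]
    by_cases h1 : src e ∈ A
    · exact Or.inl (hA h1)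
    · right; apply hA; tauto
  have hc : ((bd A).card : ℝ) = ∑ e ∈ edg D, if e ∈ bd A then (1 : ℝ) else 0 := by
    rw [Finset.sum_ite_mem, Finset.inter_eq_right.2 hsub]; simp
  rw [hc, ← Finset.sum_add_distrib]
  apply Finset.sum_le_sum
  intro e _
  have hadj := adj_edge e
  simp only [mem_bd, low]
  by_cases h1 : src e ∈ A <;> by_cases h2 : dst e ∈ A <;> simp only [h1, h2, if_true, if_false]
  · simp
  · obtain ⟨h3, h4⟩ := hb _ _ h1 h2 hadj
    have h3' : (1 : ℝ) ≤ η (src e) := by exact_mod_cast h3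
    have h4' : (η (dst e) : ℝ) ≤ 0 := by exact_mod_cast h4
    simp; nlinarith
  · obtain ⟨h3, h4⟩ := hb _ _ h2 h1 (adjP_symm hadj)
    have h3' : (1 : ℝ) ≤ η (dst e) := by exact_mod_cast h3
    have h4' : (η (src e) : ℝ) ≤ 0 := by exact_mod_cast h4
    simp; nlinarith
  · simp
def LC (S F : Set Site) : Prop := ∀ x y, x ∈ S → y ∈ S → adjP x y → x ∈ F → y ∈ F

def Conn (S : Set Site) : Prop := ∀ F, LC S F → ∀ x y, x ∈ S → y ∈ S → x ∈ F → y ∈ F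

def comp (S : Set Site) (x : Site) : Set Site := {y | y ∈ S ∧ ∀ F, LC S F → x ∈ F → y ∈ F}

lemma LC.compl {S F : Set Site} (h : LC S F) : LC S Fᶜ := fun x y hx hy ha hxF hyF =>
  hxF (h y x hy hx (adjP_symm ha) hyF)

lemma LC.mono {S T F : Set Site} (h : LC S F) (hT : T ⊆ S) : LC T F :=
  fun x y hx hy ha => h x y (hT hx) (hT hy) ha

lemma self_mem_comp {S : Set Site} {x : Site} (hx : x ∈ S) : x ∈ comp S x :=
  ⟨hx, fun _ _ h => h⟩

lemma comp_step {S : Set Site} {x y z : Site} (hy : y ∈ comp S x) (hz : z ∈ S) (ha : adjP y z) :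
    z ∈ comp S x :=
  ⟨hz, fun F hF hx => hF y z hy.1 hz ha (hy.2 F hF hx)⟩

lemma comp_conn (S : Set Site) (x : Site) : Conn (comp S x) := by
  intro F hF y z hy hz hyF
  by_contra hzF
  by_cases hx : x ∈ S
  · have h1 : LC S {w | w ∈ comp S x ∧ w ∈ F} := by
      rintro w v hw hv ha ⟨h1, h2⟩
      have := comp_step h1 hv ha
      exact ⟨this, hF w v h1 this ha h2⟩
    have h2 : LC S {w | w ∈ comp S x ∧ w ∈ Fᶜ} := by
      rintro w v hw hv ha ⟨h1, h2⟩
      have := comp_step h1 hv ha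
      exact ⟨this, hF.compl w v h1 this ha h2⟩
    by_cases hxF : x ∈ F
    · exact hzF (hz.2 _ h1 ⟨self_mem_comp hx, hxF⟩).2
    · exact (hy.2 _ h2 ⟨self_mem_comp hx, hxF⟩).2 hyF
  · have h1 : LC S {w | w = x} := by
      intro w v hw hv ha h1
      simp only [Set.mem_ofPred_eq] at h1
      subst h1; exact absurd hw hx
    have : y = x := hy.2 _ h1 rfl
    exact hx (this ▸ hy.1)

lemma comp_symm {S : Set Site} {x y : Site} (hx : x ∈ S) (h : y ∈ comp S x) : x ∈ comp S y := by
  refine ⟨hx, fun F hF hy => ?_⟩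
  by_contra hxF
  exact h.2 _ hF.compl hxF hy

lemma comp_trans {S : Set Site} {x y z : Site} (h : y ∈ comp S x) (h2 : z ∈ comp S y) :
    z ∈ comp S x := ⟨h2.1, fun F hF hx => h2.2 F hF (h.2 F hF hx)⟩

lemma adj_right (a b : ℤ) : adjP (a, b) (a + 1, b) := by simp [adjP]
lemma adj_up (a b : ℤ) : adjP (a, b) (a, b + 1) := by simp [adjP]

lemma int_const {P : ℤ → Prop} (h : ∀ n, P n ↔ P (n + 1)) (m n : ℤ) (hm : P m) : P n := by
  have : ∀ k : ℤ, P (m + k) := by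
    intro k
    induction k using Int.induction_on with
    | zero => simpa using hm
    | succ i ih => have := (h _).1 ih; rwa [add_assoc] at this
    | pred i ih =>
      apply (h _).2
      have e : m + (-(i : ℤ) - 1) + 1 = m + -(i : ℤ) := by ring
      rw [e]; exact ih
  have := this (n - m)
  rwa [add_sub_cancel] at this

lemma LC.iff {S F : Set Site} (h : LC S F) {x y : Site} (hx : x ∈ S) (hy : y ∈ S)
    (ha : adjP x y) : x ∈ F ↔ y ∈ F := ⟨h x y hx hy ha, h y x hy hx (adjP_symm ha)⟩

lemma outside_conn {C : Set Site} {N : ℤ} (hC : ∀ v ∈ C, |v.1| ≤ N ∧ |v.2| ≤ N) {v w : Site}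
    (hv : N < |v.1| ∨ N < |v.2|) (hw : N < |w.1| ∨ N < |w.2|) : w ∈ comp Cᶜ v := by
  have hout : ∀ u : Site, (N < |u.1| ∨ N < |u.2|) → u ∈ Cᶜ := by
    intro u hu huC
    have := hC u huC
    rcases hu with h | h <;> omega
  refine ⟨hout w hw, fun F hF hvF => ?_⟩
  have hrow : ∀ b a a' : ℤ, N < |b| → (a, b) ∈ F → (a', b) ∈ F := by
    intro b a a' hb h
    refine int_const (P := fun n => ((n, b) : Site) ∈ F) (fun n => ?_) a a' h
    exact hF.iff (hout _ (Or.inr hb)) (hout _ (Or.inr hb)) (adj_right n b)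
  have hcol : ∀ a b b' : ℤ, N < |a| → (a, b) ∈ F → (a, b') ∈ F := by
    intro a b b' hb h
    refine int_const (P := fun n => ((a, n) : Site) ∈ F) (fun n => ?_) b b' h
    exact hF.iff (hout _ (Or.inl hb)) (hout _ (Or.inl hb)) (adj_up a n)
  obtain ⟨a, b⟩ := v
  obtain ⟨c, d⟩ := w
  simp only at hv hw
  have hN : N < |(|N| + 1)| := by
    have := le_abs_self N
    rw [abs_of_nonneg (by positivity)]; omega
  have hM : (|N| + 1, |N| + 1) ∈ F := by
    rcases hv with h | h
    · exact hrow _ _ _ hN (hcol _ _ (|N| + 1) h hvF)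
    · exact hcol _ _ _ hN (hrow _ _ (|N| + 1) h hvF)
  rcases hw with h | h
  · exact hcol _ _ _ h (hrow _ _ c hN hM)
  · exact hrow _ _ _ h (hcol _ _ d hN hM)

lemma plane_conn : Conn Set.univ := by
  intro F hF x y _ _ hx
  have := (outside_conn (C := ∅) (N := -1) (by simp) (v := x) (w := y)
    (Or.inl (by have := abs_nonneg x.1; omega)) (Or.inl (by have := abs_nonneg y.1; omega))).2 F
  apply this _ hx
  simpa using hF

lemma hole_compl_conn {C : Set Site} (hC : Conn C) (hne : C.Nonempty) (q : Site) :
    Conn (comp Cᶜ q)ᶜ := by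
  obtain ⟨c, hc⟩ := hne
  have hCK : C ⊆ (comp Cᶜ q)ᶜ := fun v hv hvK => hvK.1 hv
  -- it suffices to link every point to `C`
  have key : ∀ F, LC (comp Cᶜ q)ᶜ F → ∀ y ∈ (comp Cᶜ q)ᶜ, y ∈ F → c ∈ F := by
    intro F hF y hy hyF
    by_cases hyC : y ∈ C
    · exact hC F (hF.mono hCK) y c hyC hc hyF
    · by_contra hcF
      have hdis : ∀ w ∈ comp Cᶜ y, w ∈ (comp Cᶜ q)ᶜ := fun w hw hwq =>
        hy (comp_trans hwq (comp_symm hyC hw))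
      have hin : ∀ w ∈ comp Cᶜ y, w ∈ F := fun w hw =>
        comp_conn Cᶜ y F (hF.mono hdis) y w (self_mem_comp hyC) hw hyF
      have hL : LC Set.univ (comp Cᶜ y) := by
        intro w v _ _ ha hw
        by_cases hv : v ∈ C
        · exfalso
          have : v ∈ F := hF w v (hdis w hw) (hCK hv) ha (hin w hw)
          exact hcF (hC F (hF.mono hCK) v c hv hc this)
        · exact comp_step hw hv ha
      exact (plane_conn _ hL y c trivial trivial (self_mem_comp hyC)).1 hc
  intro F hF x y hx hy hxF
  by_contra hyF
  exact key _ hF.compl y hy hyF (key F hF x hx hxF)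

def Good (K : Finset Site) : Prop := K.Nonempty ∧ Conn (K : Set Site) ∧ Conn (K : Set Site)ᶜ

structure Dec (Q : Set Site) (A U : Finset Site) (Γ : Finset (Finset Site)) : Prop where
  goodU : Good U
  subU : A ⊆ U
  good : ∀ K ∈ Γ, Good K
  disj : ∀ K ∈ Γ, ∀ K' ∈ Γ, K ≠ K' → Disjoint K K'
  meets : ∀ K ∈ Γ, ∃ q ∈ K, q ∈ Q ∧ q ∈ U
  cover : ∀ q ∈ Q, q ∈ U → ∃ K ∈ Γ, q ∈ K
  memA : ∀ v, v ∈ A ↔ v ∈ U ∧ ∀ K ∈ Γ, v ∉ K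
  card : (bd U).card + ∑ K ∈ Γ, (bd K).card ≤ (bd A).card

lemma box_exists (D : Finset Site) : ∃ N : ℤ, 0 ≤ N ∧ ∀ v ∈ D, |v.1| ≤ N ∧ |v.2| ≤ N := by
  induction D using Finset.induction_on with
  | empty => exact ⟨0, le_rfl, by simp⟩
  | insert a s _ ih =>
    obtain ⟨N, hN, h⟩ := ih
    refine ⟨max N (max |a.1| |a.2|), le_max_of_le_left hN, fun v hv => ?_⟩
    rcases Finset.mem_insert.1 hv with rfl | hv
    · simp
    · have := h v hv
      exact ⟨le_max_of_le_left this.1, le_max_of_le_left this.2⟩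

set_option maxHeartbeats 1000000 in
lemma fill {D : Finset Site} {T Q : Set Site} {x : Site} (hTD : ∀ v ∈ T, v ∈ D)
    (hx : x ∈ T) (hCQ : ∀ v ∈ comp T x, v ∉ Q) :
    ∃ (A U : Finset Site) (Γ : Finset (Finset Site)), Dec Q A U Γ ∧ comp T x ⊆ A ∧
      (∀ v ∈ A, v ∉ Q) ∧ ∀ a y, a ∈ A → y ∉ A → adjP a y → a ∈ T ∧ y ∉ T := by
  obtain ⟨N, hN0, hN⟩ := box_exists D
  set C := comp T x with hCdef
  have hCne : C.Nonempty := ⟨x, self_mem_comp hx⟩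
  have hCconn : Conn C := comp_conn T x
  have hCbox : ∀ v ∈ C, |v.1| ≤ N ∧ |v.2| ≤ N := fun v hv => hN v (hTD v hv.1)
  set q0 : Site := (N + 1, 0) with hq0
  have hq0out : N < |q0.1| ∨ N < |q0.2| := by
    left; rw [hq0]; simp only; rw [abs_of_nonneg (by omega)]; omega
  have hCT : ∀ a y, a ∈ C → y ∉ C → adjP a y → y ∉ T := fun a y ha hy hadj hyT =>
    hy (comp_step ha hyT hadj)
  set U : Finset Site := (Finset.Icc (-N) N ×ˢ Finset.Icc (-N) N).filter (· ∉ comp Cᶜ q0) with hU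
  have memU : ∀ v, v ∈ U ↔ v ∉ comp Cᶜ q0 := by
    intro v
    simp only [hU, Finset.mem_filter, Finset.mem_product, Finset.mem_Icc, and_iff_right_iff_imp]
    intro hv
    by_contra h
    apply hv
    apply outside_conn hCbox hq0out
    by_contra h2
    push Not at h2
    apply h
    have h3 := abs_le.1 h2.1
    have h4 := abs_le.1 h2.2
    exact ⟨⟨h3.1, h3.2⟩, ⟨h4.1, h4.2⟩⟩
  have coeU : (U : Set Site) = (comp Cᶜ q0)ᶜ := by ext v; simp [memU]
  have hCU : ∀ v ∈ C, v ∈ U := fun v hv => (memU v).2 fun h => h.1 hv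
  let hole : Site → Finset Site := fun q => U.filter (· ∈ comp Cᶜ q)
  have mem_hole : ∀ q ∈ U, ∀ v, v ∈ hole q ↔ v ∈ comp Cᶜ q := by
    intro q hq v
    simp only [hole, Finset.mem_filter, and_iff_right_iff_imp]
    intro hv
    rw [memU]
    intro hv0
    refine (memU q).1 hq (comp_trans hv0 ?_)
    by_cases hqC : q ∈ C
    · exfalso
      have h1 : LC Cᶜ {w | w = q} := by
        intro w u hw hu ha h1
        simp only [Set.mem_ofPred_eq] at h1
        subst h1; exact absurd hqC hw
      have : v = q := hv.2 _ h1 rfl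
      exact hv.1 (this ▸ hqC)
    · exact comp_symm hqC hv
  set Γ : Finset (Finset Site) := (U.filter (· ∈ Q)).image hole with hΓ
  have memΓ : ∀ K, K ∈ Γ ↔ ∃ q ∈ U, q ∈ Q ∧ hole q = K := by
    intro K; simp only [hΓ, Finset.mem_image, Finset.mem_filter, and_assoc]
  set A : Finset Site := U.filter (fun v => ∀ K ∈ Γ, v ∉ K) with hA
  have memA : ∀ v, v ∈ A ↔ v ∈ U ∧ ∀ K ∈ Γ, v ∉ K := by intro v; simp [hA]
  have hCA : C ⊆ A := by
    intro v hv
    refine Finset.mem_coe.2 ((memA v).2 ⟨hCU v hv, ?_⟩)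
    intro K hK hvK
    obtain ⟨q, hqU, hqQ, rfl⟩ := (memΓ K).1 hK
    exact ((mem_hole q hqU v).1 hvK).1 hv
  have hqC : ∀ q ∈ Q, q ∉ C := fun q hq hc => hCQ q hc hq
  -- points outside A lie in a component
  have houtA : ∀ y, y ∉ A → ∃ q, y ∈ comp Cᶜ q ∧ ∀ w ∈ comp Cᶜ q, w ∉ A := by
    intro y hy
    by_cases hyU : y ∈ U
    · have : ∃ K ∈ Γ, y ∈ K := by
        by_contra h; push Not at h
        exact hy ((memA y).2 ⟨hyU, h⟩)
      obtain ⟨K, hK, hyK⟩ := this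
      obtain ⟨q, hqU, hqQ, rfl⟩ := (memΓ K).1 hK
      refine ⟨q, (mem_hole q hqU y).1 hyK, fun w hw hwA => ?_⟩
      exact ((memA w).1 hwA).2 _ hK ((mem_hole q hqU w).2 hw)
    · refine ⟨q0, ?_, fun w hw hwA => ?_⟩
      · by_contra h; exact hyU ((memU y).2 h)
      · exact (memU w).1 ((memA w).1 hwA).1 hw
  have hdisj : ∀ K ∈ Γ, ∀ K' ∈ Γ, K ≠ K' → Disjoint K K' := by
    intro K hK K' hK' hne
    obtain ⟨q, hqU, hqQ, rfl⟩ := (memΓ K).1 hK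
    obtain ⟨q', hqU', hqQ', rfl⟩ := (memΓ K').1 hK'
    rw [Finset.disjoint_left]
    intro v hv hv'
    apply hne
    rw [mem_hole q hqU] at hv
    rw [mem_hole q' hqU'] at hv'
    ext w
    rw [mem_hole q hqU, mem_hole q' hqU']
    constructor
    · intro hw
      exact comp_trans hv' (comp_trans (comp_symm (hqC q hqQ) hv) hw)
    · intro hw
      exact comp_trans hv (comp_trans (comp_symm (hqC q' hqQ') hv') hw)
  -- crossing edges of a component
  have hcross : ∀ q a y, a ∈ comp Cᶜ q → y ∉ comp Cᶜ q → adjP a y → y ∈ C := by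
    intro q a y ha hy hadj
    by_contra h
    exact hy (comp_step ha h hadj)
  have hKbd : ∀ K ∈ Γ, ∀ e ∈ bd K, (src e ∈ K ∧ dst e ∈ C) ∨ (dst e ∈ K ∧ src e ∈ C) := by
    intro K hK e he
    obtain ⟨q, hqU, hqQ, rfl⟩ := (memΓ K).1 hK
    rw [mem_bd] at he
    have hm := mem_hole q hqU
    rw [hm, hm] at *
    by_cases h : src e ∈ comp Cᶜ q
    · left; exact ⟨h, hcross q _ _ h (by tauto) (adj_edge e)⟩
    · right; exact ⟨by tauto, hcross q _ _ (by tauto) h (adjP_symm (adj_edge e))⟩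
  have hUbd : ∀ e ∈ bd U, (src e ∉ U ∧ dst e ∈ C) ∨ (dst e ∉ U ∧ src e ∈ C) := by
    intro e he
    rw [mem_bd] at he
    rw [memU, memU] at *
    by_cases h : src e ∈ comp Cᶜ q0
    · left; exact ⟨by tauto, hcross q0 _ _ h (by tauto) (adj_edge e)⟩
    · right; exact ⟨by tauto, hcross q0 _ _ (by tauto) h (adjP_symm (adj_edge e))⟩
  have hKnotA : ∀ K ∈ Γ, ∀ v ∈ K, v ∉ A := fun K hK v hv hvA => ((memA v).1 hvA).2 K hK hv
  have hUnotA : ∀ v, v ∉ U → v ∉ A := fun v hv hvA => hv ((memA v).1 hvA).1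
  have hKU : ∀ K ∈ Γ, ∀ v ∈ K, v ∈ U := by
    intro K hK v hv
    obtain ⟨q, hqU, hqQ, rfl⟩ := (memΓ K).1 hK
    exact (Finset.mem_filter.1 hv).1
  have hKC : ∀ K ∈ Γ, ∀ v ∈ K, v ∉ C := fun K hK v hv hvC => hKnotA K hK v hv (hCA hvC)
  have hcard : (bd U).card + ∑ K ∈ Γ, (bd K).card ≤ (bd A).card := by
    rw [← Finset.card_biUnion, ← Finset.card_union_of_disjoint]
    · apply Finset.card_le_card
      intro e he
      rw [mem_bd]
      rcases Finset.mem_union.1 he with he | he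
      · rcases hUbd e he with ⟨h1, h2⟩ | ⟨h1, h2⟩
        · have h3 := hUnotA _ h1
          have h4 : dst e ∈ A := hCA h2
          exact fun h => h3 (h.2 h4)
        · have h3 := hUnotA _ h1
          have h4 : src e ∈ A := hCA h2
          exact fun h => h3 (h.1 h4)
      · obtain ⟨K, hK, he⟩ := Finset.mem_biUnion.1 he
        rcases hKbd K hK e he with ⟨h1, h2⟩ | ⟨h1, h2⟩
        · have h3 := hKnotA K hK _ h1
          have h4 : dst e ∈ A := hCA h2
          exact fun h => h3 (h.2 h4)
        · have h3 := hKnotA K hK _ h1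
          have h4 : src e ∈ A := hCA h2
          exact fun h => h3 (h.1 h4)
    · rw [Finset.disjoint_left]
      intro e he he'
      obtain ⟨K, hK, he'⟩ := Finset.mem_biUnion.1 he'
      rcases hUbd e he with ⟨h1, h2⟩ | ⟨h1, h2⟩ <;> rcases hKbd K hK e he' with ⟨h3, h4⟩ | ⟨h3, h4⟩
      · exact h1 (hKU K hK _ h3)
      · exact hKC K hK _ h3 h2
      · exact hKC K hK _ h3 h2
      · exact h1 (hKU K hK _ h3)
    · intro K hK K' hK' hne
      rw [Function.onFun, Finset.disjoint_left]
      intro e he he'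
      have hd := Finset.disjoint_left.1 (hdisj K hK K' hK' hne)
      rcases hKbd K hK e he with ⟨h1, h2⟩ | ⟨h1, h2⟩ <;>
        rcases hKbd K' hK' e he' with ⟨h3, h4⟩ | ⟨h3, h4⟩
      · exact hd h1 h3
      · exact hKC K hK _ h1 h4
      · exact hKC K hK _ h1 h4
      · exact hd h1 h3
  refine ⟨A, U, Γ, ⟨?_, ?_, ?_, hdisj, ?_, ?_, memA, hcard⟩, hCA, ?_, ?_⟩
  · refine ⟨⟨x, hCU x (self_mem_comp hx)⟩, ?_, ?_⟩
    · rw [coeU]; exact hole_compl_conn hCconn hCne q0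
    · rw [coeU, compl_compl]; exact comp_conn _ _
  · exact fun v hv => ((memA v).1 hv).1
  · intro K hK
    obtain ⟨q, hqU, hqQ, rfl⟩ := (memΓ K).1 hK
    have hcoe : (hole q : Set Site) = comp Cᶜ q := by
      ext v; exact mem_hole q hqU v
    refine ⟨⟨q, (mem_hole q hqU q).2 (self_mem_comp (hqC q hqQ))⟩, ?_, ?_⟩
    · rw [hcoe]; exact comp_conn _ _
    · rw [hcoe]; exact hole_compl_conn hCconn hCne q
  · intro K hK
    obtain ⟨q, hqU, hqQ, rfl⟩ := (memΓ K).1 hK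
    exact ⟨q, (mem_hole q hqU q).2 (self_mem_comp (hqC q hqQ)), hqQ, hqU⟩
  · intro q hqQ hqU
    exact ⟨hole q, (memΓ _).2 ⟨q, hqU, hqQ, rfl⟩, (mem_hole q hqU q).2 (self_mem_comp (hqC q hqQ))⟩
  · intro v hv hvQ
    have hvU := ((memA v).1 hv).1
    exact ((memA v).1 hv).2 (hole v) ((memΓ _).2 ⟨v, hvU, hvQ, rfl⟩)
      ((mem_hole v hvU v).2 (self_mem_comp (hqC v hvQ)))
  · intro a y ha hy hadj
    obtain ⟨q, hyq, hq⟩ := houtA y hy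
    have haC : a ∈ C := hcross q y a hyq (fun h => hq a h ha) (adjP_symm hadj)
    exact ⟨haC.1, hCT a y haC (fun h => hy (hCA h)) hadj⟩
def plaq (a b : ℤ) : Finset Edge :=
  {((a, b), false), ((a, b), true), ((a + 1, b), true), ((a, b + 1), false)}

def nbr (e : Edge) : Finset Edge :=
  plaq e.1.1 e.1.2 ∪ (if e.2 then plaq (e.1.1 - 1) e.1.2 else plaq e.1.1 (e.1.2 - 1))

lemma plaq_card (a b : ℤ) : (plaq a b).card ≤ 4 := Finset.card_le_four

lemma nbr_card (e : Edge) : (nbr e).card ≤ 8 := by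
  unfold nbr
  refine (Finset.card_union_le _ _).trans ?_
  have h1 := plaq_card e.1.1 e.1.2
  split_ifs
  · have := plaq_card (e.1.1 - 1) e.1.2; omega
  · have := plaq_card e.1.1 (e.1.2 - 1); omega

lemma nbr_of_plaq {a b : ℤ} {e e' : Edge} (h : e ∈ plaq a b) (h' : e' ∈ plaq a b) :
    e' ∈ nbr e := by
  unfold nbr
  rw [Finset.mem_union]
  simp only [plaq, Finset.mem_insert, Finset.mem_singleton] at h
  rcases h with rfl | rfl | rfl | rfl
  · left; simpa using h'
  · left; simpa using h'
  · right; simpa using h'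
  · right; simpa using h'

lemma plaq_of_nbr {e e' : Edge} (h : e' ∈ nbr e) : ∃ a b, e ∈ plaq a b ∧ e' ∈ plaq a b := by
  obtain ⟨⟨a, b⟩, d⟩ := e
  unfold nbr at h
  rw [Finset.mem_union] at h
  rcases h with h | h
  · refine ⟨a, b, ?_, h⟩
    cases d <;> simp [plaq]
  · cases d
    · exact ⟨a, b - 1, by simp [plaq], by simpa using h⟩
    · exact ⟨a - 1, b, by simp [plaq], by simpa using h⟩

lemma nbr_symm {e e' : Edge} (h : e' ∈ nbr e) : e ∈ nbr e' := by
  obtain ⟨a, b, h1, h2⟩ := plaq_of_nbr h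
  exact nbr_of_plaq h2 h1

lemma antideriv (u : ℤ → ZMod 2) : ∃ g : ℤ → ZMod 2, ∀ n, g (n + 1) = g n + u n := by
  refine ⟨fun n => ∑ i ∈ Finset.Ico 0 n, u i - ∑ i ∈ Finset.Ico n 0, u i, fun n => ?_⟩
  beta_reduce
  rcases le_or_gt 0 n with h | h
  · rw [Finset.Ico_eq_empty (a := n + 1) (b := 0) (by omega),
      Finset.Ico_eq_empty (a := n) (b := 0) (by omega)]
    have : Finset.Ico 0 (n + 1) = insert n (Finset.Ico 0 n) := by
      ext i; simp; omega
    rw [this, Finset.sum_insert (by simp)]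
    simp; ring
  · rw [Finset.Ico_eq_empty (a := 0) (b := n + 1) (by omega),
      Finset.Ico_eq_empty (a := 0) (b := n) (by omega)]
    have : Finset.Ico n 0 = insert n (Finset.Ico (n + 1) 0) := by
      ext i; simp; omega
    rw [this, Finset.sum_insert (by simp)]
    simp
    rw [add_assoc, CharTwo.add_self_eq_zero, add_zero]

lemma zmod2_add_self (a : ZMod 2) : a + a = 0 := by revert a; decide

lemma exact_form (w : Edge → ZMod 2)
    (hw : ∀ a b : ℤ, w ((a, b), false) + w ((a + 1, b), true) + w ((a, b + 1), false)
      + w ((a, b), true) = 0) :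
    ∃ F : Site → ZMod 2, ∀ e, F (dst e) = F (src e) + w e := by
  obtain ⟨g, hg⟩ := antideriv fun a => w ((a, 0), false)
  have h1 := fun a : ℤ => antideriv fun b => w ((a, b), true)
  choose c hc using h1
  let F : Site → ZMod 2 := fun v => g v.1 + (c v.1 v.2 - c v.1 0)
  have hv : ∀ a b, F (a, b + 1) = F (a, b) + w ((a, b), true) := by
    intro a b; simp only [F, hc]; ring
  have hh : ∀ a b, F (a + 1, b) = F (a, b) + w ((a, b), false) := by
    intro a b
    have hk : ∀ x y z t s r : ZMod 2, x + y + z + t = 0 → r + y = s + t + z → r = s + x := by decide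
    have hk2 : ∀ x y z t s r : ZMod 2, x + y + z + t = 0 → r = s + x → r + y = s + t + z := by decide
    refine int_const (P := fun b => F (a + 1, b) = F (a, b) + w ((a, b), false)) ?_ 0 b ?_
    · intro n
      rw [hv, hv]
      exact ⟨hk2 _ _ _ _ _ _ (hw a n), hk _ _ _ _ _ _ (hw a n)⟩
    · simp only [F, hg]; ring
  refine ⟨F, ?_⟩
  rintro ⟨⟨a, b⟩, d⟩
  cases d
  · simpa [src, dst] using hh a b
  · simpa [src, dst] using hv a b

lemma bd_conn {K : Finset Site} (hK : Good K) {R : Finset Edge} (hR : R ⊆ bd K)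
    (hne : R.Nonempty) (hcl : ∀ e ∈ R, ∀ e' ∈ nbr e, e' ∈ bd K → e' ∈ R) : bd K ⊆ R := by
  have hw : ∀ a b : ℤ, (if ((a, b), false) ∈ R then (1 : ZMod 2) else 0)
      + (if ((a + 1, b), true) ∈ R then (1 : ZMod 2) else 0)
      + (if ((a, b + 1), false) ∈ R then (1 : ZMod 2) else 0)
      + (if ((a, b), true) ∈ R then (1 : ZMod 2) else 0) = 0 := by
    intro a b
    by_cases h : ∃ e ∈ plaq a b, e ∈ R
    · obtain ⟨e, he, heR⟩ := h
      have hiff : ∀ e' ∈ plaq a b, (e' ∈ R ↔ e' ∈ bd K) := fun e' he' =>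
        ⟨fun h => hR h, fun h => hcl e heR e' (nbr_of_plaq he he') h⟩
      rw [if_congr (hiff _ (by simp [plaq])) rfl rfl, if_congr (hiff ((a + 1, b), true) (by simp [plaq])) rfl rfl,
        if_congr (hiff ((a, b + 1), false) (by simp [plaq])) rfl rfl,
        if_congr (hiff ((a, b), true) (by simp [plaq])) rfl rfl]
      simp only [mem_bd, src, dst]
      by_cases h1 : (a, b) ∈ K <;> by_cases h2 : (a + 1, b) ∈ K <;>
        by_cases h3 : (a, b + 1) ∈ K <;> by_cases h4 : (a + 1, b + 1) ∈ K <;>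
        simp [h1, h2, h3, h4] <;> decide
    · push Not at h
      have h1 := h ((a, b), false) (by simp [plaq])
      have h2 := h ((a + 1, b), true) (by simp [plaq])
      have h3 := h ((a, b + 1), false) (by simp [plaq])
      have h4 := h ((a, b), true) (by simp [plaq])
      simp [h1, h2, h3, h4]
  obtain ⟨F, hF⟩ := exact_form (fun e => if e ∈ R then 1 else 0) hw
  -- F is constant on sets not crossed by R
  have hconst : ∀ S : Set Site, Conn S → (∀ e, src e ∈ S → dst e ∈ S → e ∉ R) →
      ∀ x y, x ∈ S → y ∈ S → F x = F y := by
    intro S hS hSR x y hx hy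
    have := hS {v | F v = F x} ?_ x y hx hy rfl
    · exact this.symm
    · intro u v hu hv ha h
      rcases adj_cases ha with ⟨e, rfl, rfl⟩ | ⟨e, rfl, rfl⟩
      · have h1 := hF e
        simp only [hSR e hu hv, if_false, add_zero] at h1
        exact h1.trans h
      · have h1 := hF e
        simp only [hSR e hv hu, if_false, add_zero] at h1
        exact h1.symm.trans h
  have hin := hconst _ hK.2.1 (fun e h1 h2 h => mem_bd.1 (hR h) (by simpa using ⟨fun _ => h2, fun _ => h1⟩))
  have hout := hconst _ hK.2.2 (fun e h1 h2 h => mem_bd.1 (hR h)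
    ⟨fun h => absurd h h1, fun h => absurd h h2⟩)
  obtain ⟨e0, he0⟩ := hne
  -- any crossing edge has the same value of F difference
  have hval : ∀ e ∈ bd K, ∃ a b, a ∈ K ∧ b ∉ K ∧ (F (dst e) + F (src e) = F a + F b) ∧
      ((src e = a ∧ dst e = b) ∨ (src e = b ∧ dst e = a)) := by
    intro e he
    rw [mem_bd] at he
    by_cases h : src e ∈ K
    · exact ⟨src e, dst e, h, by tauto, add_comm _ _, Or.inl ⟨rfl, rfl⟩⟩
    · exact ⟨dst e, src e, by tauto, h, rfl, Or.inr ⟨rfl, rfl⟩⟩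
  intro e he
  obtain ⟨a, b, ha, hb, h1, -⟩ := hval e he
  obtain ⟨a', b', ha', hb', h1', -⟩ := hval e0 (hR he0)
  have e1 : F a = F a' := hin a a' ha ha'
  have e2 : F b = F b' := hout b b' hb hb'
  have h2 := hF e
  have h3 := hF e0
  by_contra hne
  simp only [hne, if_false, he0, if_true] at h2 h3
  rw [h2, e1, e2, ← h1', h3] at h1
  have hk : ∀ s t : ZMod 2, s + 0 + s = t + 1 + t → False := by decide
  exact hk _ _ h1

lemma animal (z y : ℝ) (hz : 0 ≤ z) (hy : 0 ≤ y) (hy1 : y ≤ 1) (hzy : 256 * z ≤ y) (n : ℕ) :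
    ∀ (S : Finset (Finset Edge)) (L : Finset Edge),
    (∀ s ∈ S, L ⊆ s ∧ s.card ≤ n ∧ ∀ R ⊆ s, R.Nonempty →
      (∀ e ∈ R, ∀ e' ∈ nbr e, e' ∈ s → e' ∈ R) → ∃ e ∈ R, e ∈ L) →
    ∑ s ∈ S, z ^ s.card ≤ y ^ L.card := by
  induction n with
  | zero =>
    intro S L h
    by_cases hS : S.Nonempty
    · obtain ⟨s, hs⟩ := hS
      have hs0 : s = ∅ := Finset.card_eq_zero.1 (Nat.le_zero.1 (h s hs).2.1)
      have hL : L = ∅ := Finset.subset_empty.1 (hs0 ▸ (h s hs).1)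
      have hS1 : S ⊆ {∅} := fun t ht => by
        simp [Finset.card_eq_zero.1 (Nat.le_zero.1 (h t ht).2.1)]
      calc ∑ s ∈ S, z ^ s.card ≤ ∑ s ∈ ({∅} : Finset (Finset Edge)), z ^ s.card :=
            Finset.sum_le_sum_of_subset_of_nonneg hS1 (fun _ _ _ => by positivity)
        _ ≤ _ := by simp [hL]
    · rw [Finset.not_nonempty_iff_eq_empty.1 hS]; simp; positivity
  | succ n ih =>
    intro S L h
    by_cases hL : L.Nonempty
    · obtain ⟨e, he⟩ := hL
      let T : Finset Edge → Finset Edge := fun s => (nbr e ∩ s).erase e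
      have hmap : ∀ s ∈ S, T s ∈ (nbr e).powerset := fun s _ => by
        rw [Finset.mem_powerset]
        exact (Finset.erase_subset _ _).trans Finset.inter_subset_left
      rw [← Finset.sum_fiberwise_of_maps_to hmap]
      have hfib : ∀ t ∈ (nbr e).powerset, ∑ s ∈ S with T s = t, z ^ s.card
          ≤ z * y ^ (L.card - 1) := by
        intro t _
        have hinj : Set.InjOn (fun s : Finset Edge => s.erase e)
            ((S.filter fun s => T s = t : Finset (Finset Edge)) : Set (Finset Edge)) := by
          intro s hs s' hs' hss
          have h1 := (h s (Finset.mem_filter.1 hs).1).1 he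
          have h2 := (h s' (Finset.mem_filter.1 hs').1).1 he
          have h3 : s.erase e = s'.erase e := hss
          rw [← Finset.insert_erase h1, h3, Finset.insert_erase h2]
        have hIH := ih ((S.filter fun s => T s = t).image fun s => s.erase e) (L.erase e ∪ t) ?_
        · rw [Finset.sum_image hinj] at hIH
          calc ∑ s ∈ S with T s = t, z ^ s.card
              = z * ∑ s ∈ S with T s = t, z ^ (s.erase e).card := by
                rw [Finset.mul_sum]
                apply Finset.sum_congr rfl
                intro s hs
                have h1 := (h s (Finset.mem_filter.1 hs).1).1 he
                rw [← Finset.card_erase_add_one h1]; ring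
            _ ≤ z * y ^ (L.erase e ∪ t).card := mul_le_mul_of_nonneg_left hIH hz
            _ ≤ z * y ^ (L.card - 1) := by
                apply mul_le_mul_of_nonneg_left _ hz
                apply pow_le_pow_of_le_one hy hy1
                rw [← Finset.card_erase_of_mem he]
                exact Finset.card_le_card Finset.subset_union_left
        · intro s' hs'
          obtain ⟨s, hs, rfl⟩ := Finset.mem_image.1 hs'
          obtain ⟨hsS, hsT⟩ := Finset.mem_filter.1 hs
          obtain ⟨h1, h2, h3⟩ := h s hsS
          refine ⟨?_, ?_, ?_⟩
          · apply Finset.union_subset (Finset.erase_subset_erase _ h1)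
            rw [← hsT]
            exact Finset.erase_subset_erase _ Finset.inter_subset_right
          · rw [Finset.card_erase_of_mem (h1 he)]; omega
          · intro R hR hne hcl
            by_contra hcon
            push Not at hcon
            have heR : e ∉ R := fun h => by simpa using hR h
            obtain ⟨e1, he1, he1L⟩ := h3 R (hR.trans (Finset.erase_subset _ _)) hne (by
              intro e1 he1 e' he' hs'
              by_cases hee : e' = e
              · exfalso
                subst hee
                apply hcon e1 he1
                apply Finset.mem_union_right
                rw [← hsT]
                have h5 := Finset.mem_erase.1 (hR he1)
                exact Finset.mem_erase.2 ⟨h5.1, Finset.mem_inter.2 ⟨nbr_symm he', h5.2⟩⟩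
              · exact hcl e1 he1 e' he' (Finset.mem_erase.2 ⟨hee, hs'⟩))
            apply hcon e1 he1
            apply Finset.mem_union_left
            exact Finset.mem_erase.2 ⟨fun h => heR (h ▸ he1), he1L⟩
      calc _ ≤ ∑ t ∈ (nbr e).powerset, z * y ^ (L.card - 1) := Finset.sum_le_sum hfib
        _ = 2 ^ (nbr e).card * (z * y ^ (L.card - 1)) := by
            rw [Finset.sum_const, Finset.card_powerset]; simp
        _ ≤ 2 ^ 8 * (z * y ^ (L.card - 1)) := by
            apply mul_le_mul_of_nonneg_right _ (by positivity)
            exact pow_le_pow_right₀ (by norm_num) (nbr_card e)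
        _ = (256 * z) * y ^ (L.card - 1) := by ring
        _ ≤ y * y ^ (L.card - 1) := mul_le_mul_of_nonneg_right hzy (by positivity)
        _ = y ^ L.card := by
            rw [← pow_succ', Nat.sub_add_cancel (Finset.card_pos.2 ⟨e, he⟩)]
    · have hL0 := Finset.not_nonempty_iff_eq_empty.1 hL
      have hS1 : S ⊆ {∅} := fun t ht => by
        rw [Finset.mem_singleton]
        by_contra hne
        obtain ⟨e, -, he⟩ := (h t ht).2.2 t subset_rfl (Finset.nonempty_iff_ne_empty.2 hne)
          (fun _ _ _ _ h => h)
        simp [hL0] at he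
      calc ∑ s ∈ S, z ^ s.card ≤ ∑ s ∈ ({∅} : Finset (Finset Edge)), z ^ s.card :=
            Finset.sum_le_sum_of_subset_of_nonneg hS1 (fun _ _ _ => by positivity)
        _ ≤ _ := by simp [hL0]
lemma finset_fst_bdd (K : Finset Site) : ∃ N : ℤ, ∀ v ∈ K, |v.1| ≤ N ∧ |v.2| ≤ N := by
  obtain ⟨N, -, h⟩ := box_exists K
  exact ⟨N, h⟩

lemma bd_inj {K K' : Finset Site} (h : bd K = bd K') : K = K' := by
  have hLC : LC Set.univ {v | v ∈ K ↔ v ∈ K'} := by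
    intro x y _ _ ha hx
    have : ∀ e : Edge, (src e ∈ K ↔ dst e ∈ K) ↔ (src e ∈ K' ↔ dst e ∈ K') := by
      intro e
      rw [← not_iff_not, ← mem_bd, ← mem_bd, h]
    simp only [Set.mem_ofPred_eq] at hx ⊢
    rcases adj_cases ha with ⟨e, rfl, rfl⟩ | ⟨e, rfl, rfl⟩ <;> have := this e <;> tauto
  obtain ⟨v, hv⟩ := Infinite.exists_notMem_finset (K ∪ K')
  simp only [Finset.mem_union, not_or] at hv
  ext w
  exact plane_conn _ hLC v w trivial trivial (by simp [hv])

lemma col_edge {K : Finset Site} {c b : ℤ} (h : (c, b) ∈ K) : ∃ b', ((c, b'), true) ∈ bd K := by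
  by_contra hcon
  push Not at hcon
  obtain ⟨N, hN⟩ := finset_fst_bdd K
  have := int_const (P := fun b => (c, b) ∈ K) (by
    intro n
    have := hcon n
    rw [mem_bd] at this
    simpa [src, dst] using this) b (|N| + 1) h
  have := (hN _ this).2
  have h1 := le_abs_self N
  have h2 := abs_nonneg N
  rw [abs_of_nonneg (by positivity)] at this
  omega

lemma row_edge {K : Finset Site} {c b : ℤ} (h : (b, c) ∈ K) : ∃ b', ((b', c), false) ∈ bd K := by
  by_contra hcon
  push Not at hcon
  obtain ⟨N, hN⟩ := finset_fst_bdd K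
  have := int_const (P := fun b => (b, c) ∈ K) (by
    intro n
    have := hcon n
    rw [mem_bd] at this
    simpa [src, dst] using this) b (|N| + 1) h
  have := (hN _ this).1
  have h1 := le_abs_self N
  have h2 := abs_nonneg N
  rw [abs_of_nonneg (by positivity)] at this
  omega

lemma card_bd {K : Finset Site} {I J : Finset ℤ} (hI : ∀ c ∈ I, ∃ b, (c, b) ∈ K)
    (hJ : ∀ c ∈ J, ∃ a, (a, c) ∈ K) : I.card + J.card ≤ (bd K).card := by
  have h1 : ∀ c : ℤ, ∃ b', c ∈ I → ((c, b'), true) ∈ bd K := fun c => by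
    by_cases hc : c ∈ I
    · obtain ⟨b, hb⟩ := hI c hc
      obtain ⟨b', hb'⟩ := col_edge hb
      exact ⟨b', fun _ => hb'⟩
    · exact ⟨0, fun h => absurd h hc⟩
  have h2 : ∀ c : ℤ, ∃ b', c ∈ J → ((b', c), false) ∈ bd K := fun c => by
    by_cases hc : c ∈ J
    · obtain ⟨b, hb⟩ := hJ c hc
      obtain ⟨b', hb'⟩ := row_edge hb
      exact ⟨b', fun _ => hb'⟩
    · exact ⟨0, fun h => absurd h hc⟩
  choose f hf using h1
  choose g hg using h2
  have e1 : (I.image fun c => (((c, f c), true) : Edge)).card = I.card :=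
    Finset.card_image_of_injective _ (fun a b h => by simp at h; exact h.1)
  have e2 : (J.image fun c => (((g c, c), false) : Edge)).card = J.card :=
    Finset.card_image_of_injective _ (fun a b h => by simp at h; exact h.2)
  rw [← e1, ← e2, ← Finset.card_union_of_disjoint]
  · apply Finset.card_le_card
    apply Finset.union_subset
    · intro e he
      obtain ⟨c, hc, rfl⟩ := Finset.mem_image.1 he
      exact hf c hc
    · intro e he
      obtain ⟨c, hc, rfl⟩ := Finset.mem_image.1 he
      exact hg c hc
  · rw [Finset.disjoint_left]
    intro e he he'
    obtain ⟨c, hc, rfl⟩ := Finset.mem_image.1 he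
    obtain ⟨c', hc', h⟩ := Finset.mem_image.1 he'
    simp at h

lemma conn_col {K : Finset Site} (hK : Conn (K : Set Site)) {a b a' b' c : ℤ} (h : (a, b) ∈ K)
    (h' : (a', b') ∈ K) (h1 : a ≤ c) (h2 : c ≤ a') : ∃ d, (c, d) ∈ K := by
  by_contra hcon
  push Not at hcon
  have hac : a < c := lt_of_le_of_ne h1 (fun e => hcon b (e ▸ h))
  have := hK {v | v.1 < c} (by
    rintro ⟨x1, x2⟩ ⟨y1, y2⟩ hx hy ha hxF
    simp only [Set.mem_ofPred_eq, adjP] at *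
    have hy1 : y1 ≠ c := fun e => hcon y2 (e ▸ hy)
    rcases abs_cases (x1 - y1) with h | h <;> have := abs_nonneg (x2 - y2) <;> omega)
    (a, b) (a', b') h h' hac
  simp only [Set.mem_ofPred_eq] at this
  omega

lemma conn_row {K : Finset Site} (hK : Conn (K : Set Site)) {a b a' b' c : ℤ} (h : (b, a) ∈ K)
    (h' : (b', a') ∈ K) (h1 : a ≤ c) (h2 : c ≤ a') : ∃ d, (d, c) ∈ K := by
  by_contra hcon
  push Not at hcon
  have hac : a < c := lt_of_le_of_ne h1 (fun e => hcon b (e ▸ h))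
  have := hK {v | v.2 < c} (by
    rintro ⟨x1, x2⟩ ⟨y1, y2⟩ hx hy ha hxF
    simp only [Set.mem_ofPred_eq, adjP] at *
    have hy1 : y2 ≠ c := fun e => hcon y1 (e ▸ hy)
    rcases abs_cases (x2 - y2) with h | h <;> have := abs_nonneg (x1 - y1) <;> omega)
    (b, a) (b', a') h h' hac
  simp only [Set.mem_ofPred_eq] at this
  omega

lemma conn_card {K : Finset Site} (hK : Conn (K : Set Site)) {a b : ℤ} (h : (0, 0) ∈ K)
    (h' : (a, b) ∈ K) : |a| + |b| ≤ (bd K).card := by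
  have hI : ∃ I : Finset ℤ, |a| ≤ I.card ∧ ∀ c ∈ I, ∃ b, (c, b) ∈ K := by
    rcases le_total 0 a with ha | ha
    · refine ⟨Finset.Icc 0 a, by simp [abs_of_nonneg ha], fun c hc => ?_⟩
      rw [Finset.mem_Icc] at hc
      exact conn_col hK h h' hc.1 hc.2
    · refine ⟨Finset.Icc a 0, by simp [abs_of_nonpos ha], fun c hc => ?_⟩
      rw [Finset.mem_Icc] at hc
      exact conn_col hK h' h hc.1 hc.2
  have hJ : ∃ I : Finset ℤ, |b| ≤ I.card ∧ ∀ c ∈ I, ∃ a, (a, c) ∈ K := by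
    rcases le_total 0 b with ha | ha
    · refine ⟨Finset.Icc 0 b, by simp [abs_of_nonneg ha], fun c hc => ?_⟩
      rw [Finset.mem_Icc] at hc
      exact conn_row hK h h' hc.1 hc.2
    · refine ⟨Finset.Icc b 0, by simp [abs_of_nonpos ha], fun c hc => ?_⟩
      rw [Finset.mem_Icc] at hc
      exact conn_row hK h' h hc.1 hc.2
  obtain ⟨I, h1, h2⟩ := hI
  obtain ⟨J, h3, h4⟩ := hJ
  have := card_bd h2 h4
  omega

lemma exit_time {K : Finset Site} {p : Site} (hp : p ∈ K) :
    ∃ k : ℕ, (∀ i : ℕ, i ≤ k → (p.1 + i, p.2) ∈ K) ∧ (p.1 + k + 1, p.2) ∉ K := by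
  have hex : ∃ k : ℕ, (p.1 + k + 1, p.2) ∉ K := by
    by_contra hcon
    push Not at hcon
    obtain ⟨N, hN⟩ := finset_fst_bdd K
    have := (hN _ (hcon (|N| + |p.1|).toNat)).1
    have h0 : 0 ≤ |N| + |p.1| := by positivity
    simp only at this
    rw [Int.toNat_of_nonneg h0] at this
    have h1 := le_abs_self (p.1 + (|N| + |p.1|) + 1)
    have h2 := neg_abs_le p.1
    have h3 := le_abs_self N
    omega
  refine ⟨Nat.find hex, ?_, Nat.find_spec hex⟩
  intro i hi
  rcases Nat.eq_zero_or_pos i with rfl | h0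
  · simpa using hp
  · have := Nat.find_min hex (m := i - 1) (by omega)
    rw [not_not] at this
    convert this using 2
    push_cast [Nat.cast_sub h0]
    ring

lemma geom_bound {z : ℝ} (hz : 0 ≤ z) (hz1 : z ≤ 1 / 2) (F : Finset ℕ) :
    ∑ k ∈ F, z ^ (k + 1) ≤ 2 * z := by
  have h1 : z < 1 := by linarith
  have hs := summable_geometric_of_lt_one hz h1
  calc ∑ k ∈ F, z ^ (k + 1) = z * ∑ k ∈ F, z ^ k := by
        rw [Finset.mul_sum]; exact Finset.sum_congr rfl fun _ _ => pow_succ' _ _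
    _ ≤ z * ∑' k, z ^ k := mul_le_mul_of_nonneg_left
        (hs.sum_le_tsum F fun _ _ => by positivity) hz
    _ = z * (1 - z)⁻¹ := by rw [tsum_geometric_of_lt_one hz h1]
    _ ≤ z * 2 := by
        apply mul_le_mul_of_nonneg_left _ hz
        rw [inv_le_comm₀ (by linarith) (by norm_num)]; linarith
    _ = _ := mul_comm _ _

lemma contour_sum {z : ℝ} (hz : 0 ≤ z) (hz1 : z ≤ 1 / 256) (S : Finset (Finset Site)) (p : Site)
    (hS : ∀ K ∈ S, Good K ∧ p ∈ K) : ∑ K ∈ S, (z ^ 2) ^ (bd K).card ≤ 512 * z ^ 2 := by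
  have hex : ∀ K : Finset Site, ∃ k : ℕ, K ∈ S → (∀ i : ℕ, i ≤ k → (p.1 + i, p.2) ∈ K) ∧
      (p.1 + k + 1, p.2) ∉ K := fun K => by
    by_cases h : K ∈ S
    · obtain ⟨k, hk⟩ := exit_time (hS K h).2
      exact ⟨k, fun _ => hk⟩
    · exact ⟨0, fun h' => absurd h' h⟩
  choose κ hκ using hex
  have hfib : ∀ k ∈ S.image κ, ∑ K ∈ S with κ K = k, (z ^ 2) ^ (bd K).card
      ≤ z ^ (k + 1) * (256 * z) := by
    intro k _
    calc ∑ K ∈ S with κ K = k, (z ^ 2) ^ (bd K).card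
        ≤ ∑ K ∈ S with κ K = k, z ^ (k + 1) * z ^ (bd K).card := by
          apply Finset.sum_le_sum
          intro K hK
          obtain ⟨hKS, hk⟩ := Finset.mem_filter.1 hK
          subst hk
          rw [← pow_mul, two_mul, pow_add]
          apply mul_le_mul_of_nonneg_right _ (by positivity)
          apply pow_le_pow_of_le_one hz (by linarith)
          have := card_bd (K := K) (I := (Finset.range (κ K + 1)).image fun i : ℕ => p.1 + (i : ℤ))
            (J := ∅) (by
              intro c hc
              obtain ⟨i, hi, rfl⟩ := Finset.mem_image.1 hc
              exact ⟨_, (hκ K hKS).1 i (by simpa [Nat.lt_succ_iff] using hi)⟩) (by simp)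
          rw [Finset.card_image_of_injective _ (fun a b h => by simpa using h)] at this
          simpa using this
      _ = z ^ (k + 1) * ∑ s ∈ (S.filter fun K => κ K = k).image bd, z ^ s.card := by
          rw [Finset.sum_image (fun _ _ _ _ h => bd_inj h), Finset.mul_sum]
      _ ≤ z ^ (k + 1) * (256 * z) ^ ({((p.1 + k, p.2), false)} : Finset Edge).card := by
          apply mul_le_mul_of_nonneg_left _ (by positivity)
          apply animal z (256 * z) hz (by positivity) (by linarith) le_rfl
            (((S.filter fun K => κ K = k).image bd).sup Finset.card)
          intro s hs
          refine ⟨?_, Finset.le_sup (f := Finset.card) hs, ?_⟩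
          · obtain ⟨K, hK, rfl⟩ := Finset.mem_image.1 hs
            obtain ⟨hKS, hk⟩ := Finset.mem_filter.1 hK
            rw [Finset.singleton_subset_iff, mem_bd]
            have h1 := (hκ K hKS).1 _ le_rfl
            have h2 := (hκ K hKS).2
            rw [hk] at h1 h2
            simp [src, dst, h1, h2]
          · obtain ⟨K, hK, rfl⟩ := Finset.mem_image.1 hs
            obtain ⟨hKS, hk⟩ := Finset.mem_filter.1 hK
            intro R hR hne hcl
            have := bd_conn (hS K hKS).1 hR hne hcl
            refine ⟨((p.1 + k, p.2), false), this ?_, by simp⟩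
            rw [mem_bd]
            have h1 := (hκ K hKS).1 _ le_rfl
            have h2 := (hκ K hKS).2
            rw [hk] at h1 h2
            simp [src, dst, h1, h2]
      _ = _ := by simp
  calc ∑ K ∈ S, (z ^ 2) ^ (bd K).card
      = ∑ k ∈ S.image κ, ∑ K ∈ S with κ K = k, (z ^ 2) ^ (bd K).card :=
        (Finset.sum_fiberwise_of_maps_to (fun K hK => Finset.mem_image_of_mem _ hK) _).symm
    _ ≤ ∑ k ∈ S.image κ, z ^ (k + 1) * (256 * z) := Finset.sum_le_sum hfib
    _ = (∑ k ∈ S.image κ, z ^ (k + 1)) * (256 * z) := by rw [Finset.sum_mul]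
    _ ≤ (2 * z) * (256 * z) := mul_le_mul_of_nonneg_right
        (geom_bound hz (by linarith) _) (by positivity)
    _ = _ := by ring
lemma family_sum {w : Finset Site → ℝ} (hw0 : ∀ K, 0 ≤ w K)
    (hw : ∀ (S : Finset (Finset Site)) (p : Site), (∀ K ∈ S, Good K ∧ p ∈ K) → ∑ K ∈ S, w K ≤ 1) :
    ∀ (n : ℕ) (P : Finset Site), P.card ≤ n → ∀ G : Finset (Finset (Finset Site)),
      (∀ Γ ∈ G, (∀ K ∈ Γ, Good K) ∧ (∀ K ∈ Γ, ∀ K' ∈ Γ, K ≠ K' → Disjoint K K') ∧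
        (∀ K ∈ Γ, ∃ q ∈ K, q ∈ P) ∧ (∀ q ∈ P, ∃ K ∈ Γ, q ∈ K)) →
      ∑ Γ ∈ G, ∏ K ∈ Γ, w K ≤ 1 := by
  intro n
  induction n with
  | zero =>
    intro P hP G hG
    have hP0 : P = ∅ := Finset.card_eq_zero.1 (by omega)
    have hS1 : G ⊆ {∅} := fun Γ hΓ => by
      rw [Finset.mem_singleton, Finset.eq_empty_iff_forall_notMem]
      intro K hK
      obtain ⟨q, -, hq⟩ := (hG Γ hΓ).2.2.1 K hK
      simp [hP0] at hq
    calc _ ≤ ∑ Γ ∈ ({∅} : Finset (Finset (Finset Site))), ∏ K ∈ Γ, w K :=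
          Finset.sum_le_sum_of_subset_of_nonneg hS1 (fun _ _ _ => Finset.prod_nonneg fun K _ => hw0 K)
      _ ≤ 1 := by simp
  | succ n ih =>
    intro P hP G hG
    by_cases hP0 : P.card ≤ n
    · exact ih P hP0 G hG
    obtain ⟨p, hp⟩ : P.Nonempty := Finset.card_pos.1 (by omega)
    have hex : ∀ Γ : Finset (Finset Site), ∃ K, Γ ∈ G → K ∈ Γ ∧ p ∈ K := fun Γ => by
      by_cases h : Γ ∈ G
      · obtain ⟨K, hK, hpK⟩ := (hG Γ h).2.2.2 p hp
        exact ⟨K, fun _ => ⟨hK, hpK⟩⟩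
      · exact ⟨∅, fun h' => absurd h' h⟩
    choose κ hκ using hex
    have hfib : ∀ K ∈ G.image κ, ∑ Γ ∈ G with κ Γ = K, ∏ K' ∈ Γ, w K' ≤ w K := by
      intro K hK
      have hpK : p ∈ K := by
        obtain ⟨Γ, hΓ, rfl⟩ := Finset.mem_image.1 hK
        exact (hκ Γ hΓ).2
      have hinj : Set.InjOn (fun Γ : Finset (Finset Site) => Γ.erase K)
          ((G.filter fun Γ => κ Γ = K : Finset (Finset (Finset Site))) : Set (Finset (Finset Site))) := by
        intro s hs s' hs' hss
        obtain ⟨h1, h1'⟩ := Finset.mem_filter.1 hs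
        obtain ⟨h2, h2'⟩ := Finset.mem_filter.1 hs'
        have h3 : s.erase K = s'.erase K := hss
        have h4 := (hκ s h1).1
        have h5 := (hκ s' h2).1
        rw [h1'] at h4
        rw [h2'] at h5
        rw [← Finset.insert_erase h4, h3, Finset.insert_erase h5]
      calc ∑ Γ ∈ G with κ Γ = K, ∏ K' ∈ Γ, w K'
          = w K * ∑ Γ ∈ G with κ Γ = K, ∏ K' ∈ Γ.erase K, w K' := by
            rw [Finset.mul_sum]
            apply Finset.sum_congr rfl
            intro Γ hΓ
            obtain ⟨h1, h1'⟩ := Finset.mem_filter.1 hΓ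
            have h4 := (hκ Γ h1).1
            rw [h1'] at h4
            rw [Finset.mul_prod_erase _ _ h4]
        _ = w K * ∑ Γ ∈ (G.filter fun Γ => κ Γ = K).image (fun Γ => Γ.erase K), ∏ K' ∈ Γ, w K' := by
            rw [Finset.sum_image hinj]
        _ ≤ w K * 1 := by
            apply mul_le_mul_of_nonneg_left _ (hw0 K)
            apply ih (P \ K)
            · have : (P \ K).card < P.card := Finset.card_lt_card (by
                refine ⟨Finset.sdiff_subset, fun h => ?_⟩
                have := h hp
                simp [hpK] at this)
              omega
            · intro Γ' hΓ'
              obtain ⟨Γ, hΓ, rfl⟩ := Finset.mem_image.1 hΓ'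
              obtain ⟨h1, h1'⟩ := Finset.mem_filter.1 hΓ
              have h4 := (hκ Γ h1).1
              rw [h1'] at h4
              obtain ⟨g1, g2, g3, g4⟩ := hG Γ h1
              refine ⟨fun K' h => g1 K' (Finset.mem_of_mem_erase h), fun K' h K'' h' =>
                g2 _ (Finset.mem_of_mem_erase h) _ (Finset.mem_of_mem_erase h'), ?_, ?_⟩
              · intro K' h
                obtain ⟨hne, hm⟩ := Finset.mem_erase.1 h
                obtain ⟨q, hq, hqP⟩ := g3 K' hm
                exact ⟨q, hq, Finset.mem_sdiff.2 ⟨hqP, Finset.disjoint_left.1 (g2 _ hm _ h4 hne) hq⟩⟩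
              · intro q hq
                obtain ⟨hqP, hqK⟩ := Finset.mem_sdiff.1 hq
                obtain ⟨K', hK', hqK'⟩ := g4 q hqP
                exact ⟨K', Finset.mem_erase.2 ⟨fun h => hqK (h ▸ hqK'), hK'⟩, hqK'⟩
        _ = w K := mul_one _
    calc ∑ Γ ∈ G, ∏ K ∈ Γ, w K
        = ∑ K ∈ G.image κ, ∑ Γ ∈ G with κ Γ = K, ∏ K' ∈ Γ, w K' :=
          (Finset.sum_fiberwise_of_maps_to (fun K hK => Finset.mem_image_of_mem _ hK) _).symm
      _ ≤ ∑ K ∈ G.image κ, w K := Finset.sum_le_sum hfib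
      _ ≤ 1 := by
          apply hw _ p
          intro K hK
          obtain ⟨Γ, hΓ, rfl⟩ := Finset.mem_image.1 hK
          exact ⟨(hG Γ hΓ).1 _ (hκ Γ hΓ).1, (hκ Γ hΓ).2⟩

lemma A_sum {z : ℝ} (hz : 0 ≤ z) (hz1 : z ≤ 1)
    (hw : ∀ (S : Finset (Finset Site)) (p : Site), (∀ K ∈ S, Good K ∧ p ∈ K) →
      ∑ K ∈ S, z ^ (bd K).card ≤ 1) {Q : Set Site}
    (𝒜 : Finset (Finset Site)) (U : Finset Site → Finset Site)
    (Γ : Finset Site → Finset (Finset Site)) (hD : ∀ A ∈ 𝒜, Dec Q A (U A) (Γ A)) :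
    ∑ A ∈ 𝒜, z ^ (bd A).card ≤ ∑ u ∈ 𝒜.image U, z ^ (bd u).card := by
  rw [← Finset.sum_fiberwise_of_maps_to (fun K hK => Finset.mem_image_of_mem U hK)]
  apply Finset.sum_le_sum
  intro u _
  calc ∑ A ∈ 𝒜 with U A = u, z ^ (bd A).card
      ≤ ∑ A ∈ 𝒜 with U A = u, z ^ (bd u).card * ∏ K ∈ Γ A, z ^ (bd K).card := by
        apply Finset.sum_le_sum
        intro A hA
        obtain ⟨h1, rfl⟩ := Finset.mem_filter.1 hA
        rw [Finset.prod_pow_eq_pow_sum, ← pow_add]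
        exact pow_le_pow_of_le_one hz hz1 (hD A h1).card
    _ = z ^ (bd u).card * ∑ G ∈ (𝒜.filter fun A => U A = u).image Γ, ∏ K ∈ G, z ^ (bd K).card := by
        rw [Finset.sum_image, Finset.mul_sum]
        intro A hA A' hA' h
        obtain ⟨h1, h1'⟩ := Finset.mem_filter.1 hA
        obtain ⟨h2, h2'⟩ := Finset.mem_filter.1 hA'
        ext v
        rw [(hD A h1).memA, (hD A' h2).memA, h1', h2', h]
    _ ≤ z ^ (bd u).card * 1 := by
        apply mul_le_mul_of_nonneg_left _ (by positivity)
        apply family_sum (w := fun K => z ^ (bd K).card) (fun K => by positivity) hw _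
          (u.filter fun q => q ∈ Q) le_rfl
        intro G hG
        obtain ⟨A, hA, rfl⟩ := Finset.mem_image.1 hG
        obtain ⟨h1, h1'⟩ := Finset.mem_filter.1 hA
        have hd := hD A h1
        refine ⟨hd.good, hd.disj, ?_, ?_⟩
        · intro K hK
          obtain ⟨q, h3, h4, h5⟩ := hd.meets K hK
          exact ⟨q, h3, Finset.mem_filter.2 ⟨h1' ▸ h5, h4⟩⟩
        · intro q hq
          obtain ⟨h3, h4⟩ := Finset.mem_filter.1 hq
          exact hd.cover q h4 (h1' ▸ h3)
    _ = _ := mul_one _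

lemma exp_contour {β : ℝ} (hβ : Real.exp (-β / 2) ≤ 1 / 256) (S : Finset (Finset Site)) (p : Site)
    (hS : ∀ K ∈ S, Good K ∧ p ∈ K) :
    ∑ K ∈ S, Real.exp (-β) ^ (bd K).card ≤ 512 * Real.exp (-β) := by
  have h : Real.exp (-β) = Real.exp (-β / 2) ^ 2 := by
    rw [← Real.exp_nat_mul]; congr 1; push_cast; ring
  rw [h]
  exact contour_sum (Real.exp_pos _).le hβ S p hS

lemma exp_contour_one {β : ℝ} (hβ : Real.exp (-β / 2) ≤ 1 / 256) (S : Finset (Finset Site)) (p : Site)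
    (hS : ∀ K ∈ S, Good K ∧ p ∈ K) :
    ∑ K ∈ S, Real.exp (-β) ^ (bd K).card ≤ 1 := by
  have h : Real.exp (-β) = Real.exp (-β / 2) ^ 2 := by
    rw [← Real.exp_nat_mul]; congr 1; push_cast; ring
  refine (exp_contour hβ S p hS).trans ?_
  rw [h]
  have := Real.exp_pos (-β / 2)
  nlinarith

lemma A_sum_small {β : ℝ} (hβ0 : 0 ≤ β) (hβ : Real.exp (-β / 2) ≤ 1 / 256) {Q : Set Site} {x : Site}
    (𝒜 : Finset (Finset Site)) (hD : ∀ A ∈ 𝒜, ∃ U Γ, Dec Q A U Γ ∧ x ∈ U) :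
    ∑ A ∈ 𝒜, Real.exp (-β) ^ (bd A).card ≤ 512 * Real.exp (-β) := by
  have hD' : ∀ A, ∃ U Γ, A ∈ 𝒜 → Dec Q A U Γ ∧ x ∈ U := fun A => by
    by_cases h : A ∈ 𝒜
    · obtain ⟨U, Γ, h⟩ := hD A h
      exact ⟨U, Γ, fun _ => h⟩
    · exact ⟨∅, ∅, fun h' => absurd h' h⟩
  choose U Γ h using hD'
  refine (A_sum (Real.exp_pos _).le (by simpa using hβ0) (fun S p hS => exp_contour_one hβ S p hS) 𝒜 U Γ
    (fun A hA => (h A hA).1)).trans ?_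
  apply exp_contour hβ _ x
  intro K hK
  obtain ⟨A, hA, rfl⟩ := Finset.mem_image.1 hK
  exact ⟨(h A hA).1.goodU, (h A hA).2⟩

lemma A_sum_far {β : ℝ} (hβ0 : 0 ≤ β) (hβ : Real.exp (-β / 8) ≤ 1 / 256) {Q : Set Site} {x : Site}
    (r : ℕ) (𝒜 : Finset (Finset Site))
    (hD : ∀ A ∈ 𝒜, ∃ U Γ, Dec Q A U Γ ∧ x ∈ U ∧ r ≤ (bd U).card) :
    ∑ A ∈ 𝒜, Real.exp (-β) ^ (bd A).card ≤ Real.exp (-(3 / 4) * β * (r : ℝ)) := by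
  have hβ2 : Real.exp (-β / 2) ≤ 1 / 256 := le_trans (Real.exp_le_exp.2 (by linarith)) hβ
  have hD' : ∀ A, ∃ U Γ, A ∈ 𝒜 → Dec Q A U Γ ∧ x ∈ U ∧ r ≤ (bd U).card := fun A => by
    by_cases h : A ∈ 𝒜
    · obtain ⟨U, Γ, h⟩ := hD A h
      exact ⟨U, Γ, fun _ => h⟩
    · exact ⟨∅, ∅, fun h' => absurd h' h⟩
  choose U Γ h using hD'
  refine (A_sum (Real.exp_pos _).le (by simpa using hβ0) (fun S p hS => exp_contour_one hβ2 S p hS) 𝒜 U Γ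
    (fun A hA => (h A hA).1)).trans ?_
  calc ∑ u ∈ 𝒜.image U, Real.exp (-β) ^ (bd u).card
      ≤ ∑ u ∈ 𝒜.image U, Real.exp (-(3 / 4) * β * (r : ℝ)) * Real.exp (-(β / 4)) ^ (bd u).card := by
        apply Finset.sum_le_sum
        intro K hK
        obtain ⟨A, hA, rfl⟩ := Finset.mem_image.1 hK
        have h1 : (r : ℝ) ≤ (bd (U A)).card := by exact_mod_cast (h A hA).2.2
        rw [← Real.exp_nat_mul, ← Real.exp_nat_mul, ← Real.exp_add]
        apply Real.exp_le_exp.2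
        nlinarith
    _ = Real.exp (-(3 / 4) * β * (r : ℝ)) * ∑ u ∈ 𝒜.image U, Real.exp (-(β / 4)) ^ (bd u).card := by
        rw [Finset.mul_sum]
    _ ≤ Real.exp (-(3 / 4) * β * (r : ℝ)) * 1 := by
        apply mul_le_mul_of_nonneg_left _ (Real.exp_pos _).le
        apply exp_contour_one (by convert hβ using 2; ring) _ x
        intro K hK
        obtain ⟨A, hA, rfl⟩ := Finset.mem_image.1 hK
        exact ⟨(h A hA).1.goodU, (h A hA).2.1⟩
    _ = _ := mul_one _
def wt (β : ℝ) (η : Site → ℤ) : ENNReal := ENNReal.ofReal (Real.exp (-β * dgH η))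

def W (β : ℝ) (D : Finset Site) (E : (Site → ℤ) → Prop) : ENNReal :=
  ∑' η : Site → ℤ, if InD D η ∧ E η then wt β η else 0

lemma W_mono {β : ℝ} {D : Finset Site} {E E' : (Site → ℤ) → Prop} (h : ∀ η, InD D η → E η → E' η) :
    W β D E ≤ W β D E' := by
  apply ENNReal.tsum_le_tsum
  intro η
  by_cases h1 : InD D η ∧ E η
  · rw [if_pos h1, if_pos ⟨h1.1, h η h1.1 h1.2⟩]
  · rw [if_neg h1]; exact zero_le

lemma dgW_eq (β : ℝ) (D : Finset Site) (E : (Site → ℤ) → Prop) : dgW β D E = (W β D E).toReal := by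
  unfold dgW W
  rw [ENNReal.tsum_toReal_eq]
  · apply tsum_congr
    intro η
    by_cases h1 : InD D η ∧ E η
    · rw [if_pos h1]
      refine (if_pos h1).trans ?_
      rw [wt, ENNReal.toReal_ofReal (Real.exp_pos _).le]
    · rw [if_neg h1]
      refine (if_neg h1).trans ?_
      simp
  · intro η
    split_ifs
    · exact ENNReal.ofReal_ne_top
    · simp

lemma pi_sum_finite (g : ℤ → ENNReal) (hg : ∑' n, g n ≠ ⊤) (s : Finset Edge) :
    ∑' d : Edge → ℤ, (if (∀ e ∉ s, d e = 0) then ∏ e ∈ s, g (d e) else 0) ≠ ⊤ := by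
  induction s using Finset.induction_on with
  | empty =>
    rw [tsum_eq_single (0 : Edge → ℤ)]
    · simp
    · intro d hd
      rw [if_neg]
      intro h
      exact hd (funext fun e => h e (by simp))
  | insert a s ha ih =>
    have hinj : Function.Injective fun d : Edge → ℤ => (d a, Function.update d a 0) := by
      intro d d' h
      simp only [Prod.mk.injEq] at h
      funext e
      by_cases he : e = a
      · rw [he]; exact h.1
      · have := congrFun h.2 e
        simpa [he] using this
    have hle : ∑' d : Edge → ℤ, (if (∀ e ∉ insert a s, d e = 0) then ∏ e ∈ insert a s, g (d e) else 0)
        ≤ ∑' q : ℤ × (Edge → ℤ), g q.1 * (if (∀ e ∉ s, q.2 e = 0) then ∏ e ∈ s, g (q.2 e) else 0) := by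
      refine le_trans ?_ (ENNReal.tsum_comp_le_tsum_of_injective hinj _)
      apply ENNReal.tsum_le_tsum
      intro d
      by_cases h : ∀ e ∉ insert a s, d e = 0
      · rw [if_pos h, if_pos, Finset.prod_insert ha]
        · apply le_of_eq
          congr 1
          apply Finset.prod_congr rfl
          intro e he
          have : e ≠ a := fun h => ha (h ▸ he)
          simp [this]
        · intro e he
          by_cases hea : e = a
          · simp [hea]
          · simp [hea, h e (by simp [hea, he])]
      · rw [if_neg h]; exact zero_le
    refine ne_top_of_le_ne_top ?_ hle
    rw [ENNReal.tsum_prod (f := fun (n : ℤ) (d : Edge → ℤ) => g n * (if (∀ e ∉ s, d e = 0) then ∏ e ∈ s, g (d e) else 0))]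
    simp_rw [ENNReal.tsum_mul_left, ENNReal.tsum_mul_right]
    exact ENNReal.mul_ne_top hg ih

lemma gauss_summable {β : ℝ} (hβ : 0 < β) :
    ∑' n : ℤ, ENNReal.ofReal (Real.exp (-β * (n : ℝ) ^ 2)) ≠ ⊤ := by
  have hs : Summable fun n : ℤ => Real.exp (-β * |(n : ℝ)|) := by
    apply Summable.of_nat_of_neg
    · have := Real.summable_exp_nat_mul_iff.2 (neg_lt_zero.2 hβ)
      simpa [mul_comm] using this
    · have := Real.summable_exp_nat_mul_iff.2 (neg_lt_zero.2 hβ)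
      simpa [mul_comm] using this
  have hs2 : Summable fun n : ℤ => Real.exp (-β * (n : ℝ) ^ 2) := by
    refine Summable.of_nonneg_of_le (fun n => (Real.exp_pos _).le) (fun n => ?_) hs
    apply Real.exp_le_exp.2
    have : |(n : ℝ)| ≤ (n : ℝ) ^ 2 := by
      have h1 : |n| ≤ n ^ 2 := by
        rcases abs_cases n with h | h <;> nlinarith
      exact_mod_cast h1
    nlinarith
  exact hs2.tsum_ofReal_ne_top

def grad (η : Site → ℤ) : Edge → ℤ := fun e => η (src e) - η (dst e)

lemma grad_inj {D : Finset Site} {η η' : Site → ℤ} (h : InD D η) (h' : InD D η')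
    (hg : grad η = grad η') : η = η' := by
  have hLC : LC Set.univ {v | η v = η' v} := by
    intro x y _ _ ha hx
    simp only [Set.mem_ofPred_eq] at hx ⊢
    rcases adj_cases ha with ⟨e, rfl, rfl⟩ | ⟨e, rfl, rfl⟩ <;> have := congrFun hg e <;>
      simp only [grad] at this <;> omega
  obtain ⟨v, hv⟩ := Infinite.exists_notMem_finset D
  funext w
  exact plane_conn _ hLC v w trivial trivial (by simp [h v hv, h' v hv])

lemma W_sub (β : ℝ) (D : Finset Site) (E : (Site → ℤ) → Prop) :
    W β D E = ∑' η : {η : Site → ℤ // InD D η}, if E η then wt β η else 0 := by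
  unfold W
  have := tsum_subtype {η : Site → ℤ | InD D η} (fun η => if E η then wt β η else (0 : ENNReal))
  refine Eq.trans ?_ this.symm
  apply tsum_congr
  intro η
  by_cases h1 : InD D η
  · rw [Set.indicator_of_mem (by exact h1)]; simp [h1]
  · rw [Set.indicator_of_notMem (by exact h1)]; simp [h1]

lemma W_ne_top {β : ℝ} (hβ : 0 < β) (D : Finset Site) (E : (Site → ℤ) → Prop) : W β D E ≠ ⊤ := by
  have h1 : W β D E ≤ W β D (fun _ => True) := W_mono fun _ _ _ => trivial
  refine ne_top_of_le_ne_top ?_ h1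
  rw [W_sub]
  refine ne_top_of_le_ne_top (pi_sum_finite (fun n : ℤ => ENNReal.ofReal (Real.exp (-β * (n : ℝ) ^ 2)))
    (gauss_summable hβ) (edg D)) ?_
  have hinj : Function.Injective fun η : {η : Site → ℤ // InD D η} => grad η := by
    intro η η' h
    exact Subtype.ext (grad_inj η.2 η'.2 h)
  refine le_trans ?_ (ENNReal.tsum_comp_le_tsum_of_injective hinj _)
  apply ENNReal.tsum_le_tsum
  rintro ⟨η, hη⟩
  simp only [if_true]
  rw [if_pos]
  · rw [wt, dgH_eq hη, Finset.mul_sum, Real.exp_sum, ENNReal.ofReal_prod_of_nonneg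
      (fun _ _ => (Real.exp_pos _).le)]
    rfl
  · intro e he
    simp only [mem_edg, not_or] at he
    simp [grad, hη _ he.1, hη _ he.2]

lemma wt_pos (β : ℝ) (η : Site → ℤ) : wt β η ≠ 0 := by
  simp [wt, Real.exp_pos]

lemma Z_ne_zero (β : ℝ) (D : Finset Site) : W β D (fun _ => True) ≠ 0 := by
  intro h
  rw [W, ENNReal.tsum_eq_zero] at h
  have := h 0
  rw [if_pos ⟨fun _ _ => rfl, trivial⟩] at this
  exact wt_pos _ _ this

lemma W_neg (β : ℝ) (D : Finset Site) (E : (Site → ℤ) → Prop) :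
    W β D (fun η => E (-η)) = W β D E := by
  unfold W
  rw [← (Equiv.neg (Site → ℤ)).tsum_eq]
  apply tsum_congr
  intro η
  have : InD D (-η) ↔ InD D η := by simp [InD]
  simp [this, wt, dgH_neg]

lemma peierls {β c : ℝ} {D : Finset Site} {E E' : (Site → ℤ) → Prop} (PA : Finset Site → Prop)
    (hβ : 0 ≤ β)
    (hc : ∀ 𝒜 : Finset (Finset Site), (∀ A ∈ 𝒜, PA A) → ∑ A ∈ 𝒜, Real.exp (-β) ^ (bd A).card ≤ c)
    (h : ∀ η, InD D η → E η → ∃ A, PA A ∧ A ⊆ D ∧ BC A η ∧ E' (low A η)) :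
    W β D E ≤ ENNReal.ofReal c * W β D E' := by
  set f : (Site → ℤ) → ENNReal := fun η => if InD D η ∧ E' η then wt β η else 0 with hf
  set S := D.powerset.filter PA with hS
  calc W β D E ≤ ∑' η, ∑ A ∈ S, ENNReal.ofReal (Real.exp (-β) ^ (bd A).card) * f (low A η) := by
        apply ENNReal.tsum_le_tsum
        intro η
        by_cases h1 : InD D η ∧ E η
        · rw [if_pos h1]
          obtain ⟨A, hA, hAD, hBC, hE⟩ := h η h1.1 h1.2
          have hAS : A ∈ S := by simp [hS, hA, hAD]
          refine le_trans ?_ (Finset.single_le_sum (f := fun A =>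
            ENNReal.ofReal (Real.exp (-β) ^ (bd A).card) * f (low A η)) (fun _ _ => zero_le) hAS)
          simp only [hf]
          rw [if_pos ⟨low_InD hAD h1.1, hE⟩, wt, wt, ← ENNReal.ofReal_mul (by positivity)]
          apply ENNReal.ofReal_le_ofReal
          rw [← Real.exp_nat_mul, ← Real.exp_add]
          apply Real.exp_le_exp.2
          have := dgH_low hAD h1.1 hBC
          nlinarith
        · rw [if_neg h1]; exact zero_le
    _ = ∑ A ∈ S, ∑' η, ENNReal.ofReal (Real.exp (-β) ^ (bd A).card) * f (low A η) := by
        rw [Summable.tsum_finsetSum (fun _ _ => ENNReal.summable)]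
    _ ≤ ∑ A ∈ S, ENNReal.ofReal (Real.exp (-β) ^ (bd A).card) * W β D E' := by
        apply Finset.sum_le_sum
        intro A _
        rw [ENNReal.tsum_mul_left]
        gcongr
        exact ENNReal.tsum_comp_le_tsum_of_injective (low_inj A) f
    _ = ENNReal.ofReal (∑ A ∈ S, Real.exp (-β) ^ (bd A).card) * W β D E' := by
        rw [ENNReal.ofReal_sum_of_nonneg (fun _ _ => by positivity), Finset.sum_mul]
    _ ≤ _ := by
        gcongr
        apply hc
        intro A hA
        exact (Finset.mem_filter.1 hA).2

/-- generic lowering around a point -/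
lemma peierls_pt {β : ℝ} (hβ0 : 0 ≤ β) (hβ : Real.exp (-β / 2) ≤ 1 / 256)
    {D : Finset Site} {E E' : (Site → ℤ) → Prop} (Q : Set Site) (x : Site)
    (hQ : ∀ v ∉ D, v ∈ Q) (hx : ∀ η, E η → 1 ≤ η x)
    (hav : ∀ η, InD D η → E η → ∀ v ∈ comp {v | 1 ≤ η v} x, v ∉ Q)
    (hE : ∀ η, InD D η → E η → ∀ A : Finset Site, x ∈ A → (∀ v ∈ A, v ∉ Q) →
      (∀ a y, a ∈ A → y ∉ A → adjP a y → 1 ≤ η a ∧ η y ≤ 0) → E' (low A η)) :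
    W β D E ≤ ENNReal.ofReal (512 * Real.exp (-β)) * W β D E' := by
  apply peierls (fun A => ∃ U Γ, Dec Q A U Γ ∧ x ∈ U) hβ0
  · intro 𝒜 h
    exact A_sum_small hβ0 hβ 𝒜 h
  · intro η h1 h2
    have hTD : ∀ v ∈ {v | 1 ≤ η v}, v ∈ D := by
      intro v hv
      by_contra hvD
      have := h1 v hvD
      simp only [Set.mem_ofPred_eq] at hv
      omega
    obtain ⟨A, U, Γ, hDec, hCA, hAQ, hbd⟩ := fill hTD (hx η h2) (hav η h1 h2)
    have hxA : x ∈ A := hCA (self_mem_comp (hx η h2))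
    have hBC : ∀ a y, a ∈ A → y ∉ A → adjP a y → 1 ≤ η a ∧ η y ≤ 0 := by
      intro a y ha hy hay
      obtain ⟨h3, h4⟩ := hbd a y ha hy hay
      simp only [Set.mem_ofPred_eq] at h3 h4
      omega
    refine ⟨A, ⟨U, Γ, hDec, hDec.subU hxA⟩, ?_, hBC, hE η h1 h2 A hxA hAQ hBC⟩
    intro v hv
    by_contra hvD
    exact hAQ v hv (hQ v hvD)
def Sepp (S : Finset Site) (η : Site → ℤ) : Prop :=
  ∃ R : Set Site, (0, 0) ∈ R ∧ (∀ s ∈ S, s ∉ R) ∧ (∀ v ∈ R, 1 ≤ η v) ∧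
    ∀ v y, v ∈ R → y ∉ R → adjP v y → η y ≤ 0

lemma first_term {β : ℝ} (hβ0 : 0 ≤ β) (hβ : Real.exp (-β / 8) ≤ 1 / 256) (V S : Finset Site)
    (r : ℕ) (hS : ∀ s ∈ S, (r : ℤ) ≤ |s.1| + |s.2|) {h : ℤ} (hh : 1 ≤ h) :
    W β V (fun η => η (0, 0) = h ∧ ¬ Sepp S η) ≤
      ENNReal.ofReal (Real.exp (-(3 / 4) * β * (r : ℝ))) * W β V (fun η => η (0, 0) = h - 1) := by
  apply peierls (fun A => ∃ U Γ, Dec ((V : Set Site)ᶜ) A U Γ ∧ (0, 0) ∈ U ∧ r ≤ (bd U).card) hβ0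
  · intro 𝒜 h
    exact A_sum_far hβ0 hβ r 𝒜 h
  · rintro η h1 ⟨h2, hsep⟩
    have hTD : ∀ v ∈ {v | 1 ≤ η v}, v ∈ V := by
      intro v hv
      by_contra hvD
      have := h1 v hvD
      simp only [Set.mem_ofPred_eq] at hv
      omega
    have h0 : ((0, 0) : Site) ∈ {v | 1 ≤ η v} := by
      simp only [Set.mem_ofPred_eq]; omega
    obtain ⟨A, U, Γ, hDec, hCA, hAQ, hbd⟩ := fill hTD h0
      (Q := (V : Set Site)ᶜ) (fun v hv => by simpa using hTD v hv.1)
    have h0A : (0, 0) ∈ A := hCA (self_mem_comp h0)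
    have hBC : ∀ a y, a ∈ A → y ∉ A → adjP a y → 1 ≤ η a ∧ η y ≤ 0 := by
      intro a y ha hy hay
      obtain ⟨h3, h4⟩ := hbd a y ha hy hay
      simp only [Set.mem_ofPred_eq] at h3 h4
      omega
    have hs : ∃ s ∈ S, s ∈ comp {v | 1 ≤ η v} (0, 0) := by
      by_contra hcon
      push Not at hcon
      apply hsep
      refine ⟨comp {v | 1 ≤ η v} (0, 0), self_mem_comp h0, hcon, fun v hv => hv.1, ?_⟩
      intro v y hv hy ha
      by_contra hc
      exact hy (comp_step hv (by simp only [Set.mem_ofPred_eq]; omega) ha)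
    obtain ⟨⟨a, b⟩, hsS, hsC⟩ := hs
    refine ⟨A, ⟨U, Γ, hDec, hDec.subU h0A, ?_⟩, ?_, hBC, ?_⟩
    · have := conn_card hDec.goodU.2.1 (hDec.subU h0A) (hDec.subU (hCA hsC))
      have h2 := hS _ hsS
      simp only at h2
      omega
    · intro v hv
      by_contra hvD
      exact hAQ v hv (by simpa using hvD)
    · simp [low, h0A, h2]

lemma chain_step {β : ℝ} (hβ0 : 0 ≤ β) (hβ : Real.exp (-β / 2) ≤ 1 / 256) (D S : Finset Site)
    {x : Site} (hxS : x ∈ S) {h : ℤ} (hh : 1 ≤ h) :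
    W β D (fun η => η (0, 0) = h ∧ Sepp S η) ≤ W β (D.erase x) (fun η => η (0, 0) = h ∧ Sepp S η) +
      ENNReal.ofReal (1024 * Real.exp (-β)) * W β D (fun η => η (0, 0) = h ∧ Sepp S η) := by
  set E : (Site → ℤ) → Prop := fun η => η (0, 0) = h ∧ Sepp S η with hE
  have hp : W β D (fun η => E η ∧ 1 ≤ η x) ≤ ENNReal.ofReal (512 * Real.exp (-β)) * W β D E := by
    apply peierls_pt hβ0 hβ ((D : Set Site)ᶜ ∪ {(0, 0)}) x
    · intro v hv; left; simpa using hv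
    · intro η hη; exact hη.2
    · rintro η hI ⟨⟨h0, R, hR0, hRS, hR1, hRb⟩, hx⟩ v hv
      simp only [Set.mem_union, Set.mem_compl_iff, Finset.mem_coe, Set.mem_singleton_iff, not_or, not_not]
      have hv1 : 1 ≤ η v := hv.1
      constructor
      · by_contra hvD
        have := hI v hvD
        omega
      · rintro rfl
        have hLC : LC {v | 1 ≤ η v} R := by
          intro a b ha hb hab haR
          by_contra hbR
          have := hRb a b haR hbR hab
          simp only [Set.mem_ofPred_eq] at hb
          omega
        exact hv.2 _ hLC.compl (hRS x hxS) hR0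
    · rintro η hI ⟨⟨h0, R, hR0, hRS, hR1, hRb⟩, hx⟩ A hxA hAQ hbd
      have h0A : (0, 0) ∉ A := fun h => hAQ _ h (Or.inr rfl)
      refine ⟨by simp [low, h0A, h0], R \ A, ⟨hR0, h0A⟩, fun s hs hs' => hRS s hs hs'.1, ?_, ?_⟩
      · rintro v ⟨hv, hvA⟩
        have hvA' : v ∉ A := hvA
        simpa [low, hvA'] using hR1 v hv
      · rintro v y ⟨hv, hvA⟩ hy ha
        have hvA' : v ∉ A := hvA
        have h1 := hR1 v hv
        by_cases hyA : y ∈ A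
        · have := hbd y v hyA hvA (adjP_symm ha)
          omega
        · have hyR : y ∉ R := fun h => hy ⟨h, hyA⟩
          simpa [low, hyA] using hRb v y hv hyR ha
  have hm : W β D (fun η => E η ∧ η x ≤ -1) ≤ ENNReal.ofReal (512 * Real.exp (-β)) * W β D E := by
    rw [← W_neg β D E, ← W_neg β D (fun η => E η ∧ η x ≤ -1)]
    apply peierls_pt hβ0 hβ ((D : Set Site)ᶜ ∪ {(0, 0)}) x
    · intro v hv; left; simpa using hv
    · rintro ζ ⟨-, hζ⟩
      simp only [Pi.neg_apply] at hζ; omega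
    · rintro ζ hI ⟨⟨h0, R, hR0, hRS, hR1, hRb⟩, hx⟩ v hv
      simp only [Set.mem_union, Set.mem_compl_iff, Finset.mem_coe, Set.mem_singleton_iff, not_or, not_not]
      have hv1 : 1 ≤ ζ v := hv.1
      constructor
      · by_contra hvD
        have := hI v hvD
        omega
      · rintro rfl
        simp only [Pi.neg_apply] at h0
        omega
    · rintro ζ hI ⟨⟨h0, R, hR0, hRS, hR1, hRb⟩, hx⟩ A hxA hAQ hbd
      have h0A : (0, 0) ∉ A := fun h => hAQ _ h (Or.inr rfl)
      simp only [Pi.neg_apply] at h0 hR1 hRb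
      refine ⟨by simp [low, h0A, h0], R \ A, ⟨hR0, h0A⟩, fun s hs hs' => hRS s hs hs'.1, ?_, ?_⟩
      · rintro v ⟨hv, hvA⟩
        have hvA' : v ∉ A := hvA
        simpa [low, hvA'] using hR1 v hv
      · rintro v y ⟨hv, hvA⟩ hy ha
        have hvA' : v ∉ A := hvA
        have h1 := hR1 v hv
        by_cases hyA : y ∈ A
        · have := hbd y v hyA hvA (adjP_symm ha)
          simp [low, hyA]; omega
        · have hyR : y ∉ R := fun h => hy ⟨h, hyA⟩
          simpa [low, hyA] using hRb v y hv hyR ha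
  calc W β D E ≤ W β (D.erase x) E + (W β D (fun η => E η ∧ 1 ≤ η x) + W β D (fun η => E η ∧ η x ≤ -1)) := by
        unfold W
        rw [← ENNReal.tsum_add, ← ENNReal.tsum_add]
        apply ENNReal.tsum_le_tsum
        intro η
        by_cases h1 : InD D η ∧ E η
        · rw [if_pos h1]
          rcases lt_trichotomy (η x) 0 with hx | hx | hx
          · rw [if_pos (c := InD D η ∧ E η ∧ η x ≤ -1) ⟨h1.1, h1.2, by omega⟩, ← add_assoc]
            exact le_add_self
          · rw [if_pos (c := InD (D.erase x) η ∧ E η)]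
            · exact le_self_add
            · refine ⟨fun v hv => ?_, h1.2⟩
              by_cases hvx : v = x
              · rw [hvx, hx]
              · exact h1.1 v (fun h => hv (Finset.mem_erase.2 ⟨hvx, h⟩))
          · rw [if_pos (c := InD D η ∧ E η ∧ 1 ≤ η x) ⟨h1.1, h1.2, by omega⟩]
            exact le_add_left le_self_add
        · rw [if_neg h1]; exact zero_le
    _ ≤ W β (D.erase x) E + (ENNReal.ofReal (512 * Real.exp (-β)) * W β D E +
          ENNReal.ofReal (512 * Real.exp (-β)) * W β D E) := by gcongr
    _ = _ := by
        rw [← add_mul, ← ENNReal.ofReal_add (by positivity) (by positivity)]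
        congr 3; ring

lemma ennreal_absorb {a b : ENNReal} {δ : ℝ} (ha : a ≠ ⊤) (hb : b ≠ ⊤) (h0 : 0 ≤ δ) (h1 : δ < 1)
    (h : a ≤ b + ENNReal.ofReal δ * a) : a ≤ ENNReal.ofReal (1 / (1 - δ)) * b := by
  lift a to NNReal using ha
  lift b to NNReal using hb
  have h2 : (a : ℝ) ≤ b + δ * a := by
    have := ENNReal.toReal_mono (by
      exact ENNReal.add_ne_top.2 ⟨ENNReal.coe_ne_top, ENNReal.mul_ne_top ENNReal.ofReal_ne_top ENNReal.coe_ne_top⟩) h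
    rwa [ENNReal.toReal_add ENNReal.coe_ne_top (ENNReal.mul_ne_top ENNReal.ofReal_ne_top ENNReal.coe_ne_top),
      ENNReal.toReal_mul, ENNReal.toReal_ofReal h0] at this
  have h3 : (a : ℝ) ≤ 1 / (1 - δ) * b := by
    rw [one_div, ← div_eq_inv_mul, le_div_iff₀ (by linarith)]
    linarith
  have h4 : (0 : ℝ) ≤ 1 / (1 - δ) := one_div_nonneg.2 (by linarith)
  rw [← ENNReal.ofReal_coe_nnreal (p := a), ← ENNReal.ofReal_coe_nnreal (p := b), ← ENNReal.ofReal_mul h4]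
  exact ENNReal.ofReal_le_ofReal h3

lemma chain {β : ℝ} (hβ0 : 0 < β) (hβ : Real.exp (-β / 2) ≤ 1 / 256) (hδ : 1024 * Real.exp (-β) < 1)
    (D S : Finset Site) {h : ℤ} (hh : 1 ≤ h) (S' : Finset Site) (hS' : S' ⊆ S) :
    W β D (fun η => η (0, 0) = h ∧ Sepp S η) ≤
      ENNReal.ofReal (1 / (1 - 1024 * Real.exp (-β))) ^ S'.card *
        W β (D \ S') (fun η => η (0, 0) = h ∧ Sepp S η) := by
  induction S' using Finset.induction_on with
  | empty => simp
  | insert a s ha ih =>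
    refine (ih (fun v hv => hS' (Finset.mem_insert_of_mem hv))).trans ?_
    rw [Finset.card_insert_of_notMem ha, pow_succ, mul_assoc]
    gcongr
    have := chain_step hβ0.le hβ (D \ s) S (hS' (Finset.mem_insert_self a s)) hh
    have h2 := ennreal_absorb (W_ne_top hβ0 _ _) (W_ne_top hβ0 _ _) (by positivity) hδ this
    rwa [show D \ insert a s = (D \ s).erase a by ext v; simp; tauto]

lemma InD.mono {D D' : Finset Site} {η : Site → ℤ} (h : InD D η) (hD : D ⊆ D') : InD D' η :=
  fun x hx => h x fun h' => hx (hD h')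

lemma W_mono_D {β : ℝ} {D D' : Finset Site} (hD : D ⊆ D') (E : (Site → ℤ) → Prop) :
    W β D E ≤ W β D' E := by
  apply ENNReal.tsum_le_tsum
  intro η
  by_cases h1 : InD D η ∧ E η
  · rw [if_pos h1, if_pos ⟨h1.1.mono hD, h1.2⟩]
  · rw [if_neg h1]; exact zero_le

lemma dgH_add {D1 D2 : Finset Site} {η1 η2 : Site → ℤ} (h1 : InD D1 η1) (h2 : InD D2 η2)
    (hd : ∀ x ∈ D1, x ∉ D2) (hadj : ∀ x ∈ D1, ∀ y ∈ D2, ¬ adjP x y) :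
    dgH (η1 + η2) = dgH η1 + dgH η2 := by
  have g1 : InD (D1 ∪ D2) η1 := h1.mono Finset.subset_union_left
  have g2 : InD (D1 ∪ D2) η2 := h2.mono Finset.subset_union_right
  have g3 : InD (D1 ∪ D2) (η1 + η2) := fun x hx => by simp [g1 x hx, g2 x hx]
  rw [dgH_eq g1, dgH_eq g2, dgH_eq g3, ← Finset.sum_add_distrib]
  apply Finset.sum_congr rfl
  intro e _
  have ha := adj_edge e
  simp only [Pi.add_apply]
  by_cases hc : src e ∈ D1 ∨ dst e ∈ D1
  · have k1 : src e ∉ D2 := by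
      rcases hc with hc | hc
      · exact hd _ hc
      · exact fun h => hadj _ hc _ h (adjP_symm ha)
    have k2 : dst e ∉ D2 := by
      rcases hc with hc | hc
      · exact fun h => hadj _ hc _ h ha
      · exact hd _ hc
    simp [h2 _ k1, h2 _ k2]
  · push Not at hc
    simp [h1 _ hc.1, h1 _ hc.2]

lemma W_factor (β : ℝ) {D1 D2 : Finset Site}
    (hd : ∀ x ∈ D1, x ∉ D2) (hadj : ∀ x ∈ D1, ∀ y ∈ D2, ¬ adjP x y) {p : Site} (hp : p ∉ D2)
    (P : ℤ → Prop) :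
    W β (D1 ∪ D2) (fun η => P (η p)) = W β D1 (fun η => P (η p)) * W β D2 (fun _ => True) := by
  have key : ∀ ξ : {η : Site → ℤ // InD (D1 ∪ D2) η}, InD D1 (fun x => if x ∈ D1 then ξ.1 x else 0) ∧
      InD D2 (fun x => if x ∈ D2 then ξ.1 x else 0) := fun ξ =>
    ⟨fun x hx => by simp [hx], fun x hx => by simp [hx]⟩
  let e : {η : Site → ℤ // InD D1 η} × {η : Site → ℤ // InD D2 η} ≃ {η : Site → ℤ // InD (D1 ∪ D2) η} :=
    { toFun := fun q => ⟨q.1.1 + q.2.1, fun x hx => by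
        simp only [Finset.mem_union, not_or] at hx
        simp [q.1.2 x hx.1, q.2.2 x hx.2]⟩
      invFun := fun ξ => (⟨_, (key ξ).1⟩, ⟨_, (key ξ).2⟩)
      left_inv := by
        rintro ⟨⟨η1, h1⟩, ⟨η2, h2⟩⟩
        apply Prod.ext
        · apply Subtype.ext
          funext x
          by_cases hx : x ∈ D1
          · simp [hx, h2 x (hd x hx)]
          · simp [hx, h1 x hx]
        · apply Subtype.ext
          funext x
          by_cases hx : x ∈ D2
          · simp [hx, h1 x (fun h => hd x h hx)]
          · simp [hx, h2 x hx]
      right_inv := by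
        rintro ⟨ξ, h⟩
        apply Subtype.ext
        funext x
        by_cases hx : x ∈ D1
        · simp [hx, hd x hx]
        · by_cases hx2 : x ∈ D2
          · simp [hx, hx2]
          · simp [hx, hx2, h x (by simp [hx, hx2])] }
  rw [W_sub, W_sub, W_sub, ← e.tsum_eq, ← ENNReal.tsum_mul_right]
  simp_rw [← ENNReal.tsum_mul_left]
  simp only [if_true]
  rw [← ENNReal.tsum_prod (f := fun (a : {η : Site → ℤ // InD D1 η}) (b : {η : Site → ℤ // InD D2 η}) =>
    (if P (a.1 p) then wt β a.1 else 0) * wt β b.1)]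
  apply tsum_congr
  rintro ⟨⟨η1, h1⟩, ⟨η2, h2⟩⟩
  have : (e (⟨η1, h1⟩, ⟨η2, h2⟩)).1 = η1 + η2 := rfl
  simp only [this, Pi.add_apply, h2 p hp, add_zero, if_true]
  by_cases hP : P (η1 p)
  · simp only [hP, if_true, wt]
    rw [dgH_add h1 h2 hd hadj, ← ENNReal.ofReal_mul (Real.exp_pos _).le, ← Real.exp_add]
    congr 2; ring
  · simp [hP]

lemma ge_step {β : ℝ} (hβ0 : 0 ≤ β) (hβ : Real.exp (-β / 2) ≤ 1 / 256) (D : Finset Site)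
    {h : ℤ} (hh : 1 ≤ h) :
    W β D (fun η => h ≤ η (0, 0)) ≤ W β D (fun η => η (0, 0) = h) +
      ENNReal.ofReal (512 * Real.exp (-β)) * W β D (fun η => h ≤ η (0, 0)) := by
  have hp : W β D (fun η => h + 1 ≤ η (0, 0)) ≤
      ENNReal.ofReal (512 * Real.exp (-β)) * W β D (fun η => h ≤ η (0, 0)) := by
    apply peierls_pt hβ0 hβ ((D : Set Site)ᶜ) (0, 0)
    · intro v hv; simpa using hv
    · intro η hη; omega
    · intro η hI hη v hv
      simp only [Set.mem_compl_iff, Finset.mem_coe, not_not]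
      have hv1 : 1 ≤ η v := hv.1
      by_contra hvD
      have := hI v hvD
      omega
    · intro η hI hη A hxA hAQ hbd
      simp [low, hxA]; omega
  refine le_trans ?_ (add_le_add_right hp _)
  unfold W
  rw [← ENNReal.tsum_add]
  apply ENNReal.tsum_le_tsum
  intro η
  by_cases h1 : InD D η ∧ h ≤ η (0, 0)
  · rw [if_pos h1]
    by_cases h2 : η (0, 0) = h
    · rw [if_pos (c := InD D η ∧ η (0, 0) = h) ⟨h1.1, h2⟩]
      exact le_self_add
    · rw [if_pos (c := InD D η ∧ h + 1 ≤ η (0, 0)) ⟨h1.1, by omega⟩]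
      exact le_add_self
  · rw [if_neg h1]; exact zero_le

lemma mem_ball {r : ℕ} {x : Site} : x ∈ ball r ↔ x.1 ^ 2 + x.2 ^ 2 ≤ (r : ℤ) ^ 2 := by
  have hr : ((x.1 : ℝ) ^ 2 + (x.2 : ℝ) ^ 2 ≤ (r : ℝ) ^ 2) ↔ x.1 ^ 2 + x.2 ^ 2 ≤ (r : ℤ) ^ 2 := by
    exact_mod_cast Iff.rfl
  simp only [ball, Finset.mem_filter, hr, Finset.mem_product, Finset.mem_Icc, Int.ceil_natCast]
  constructor
  · exact fun h => h.2
  · intro h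
    have h1 : |x.1| ≤ (r : ℤ) := abs_le_of_sq_le_sq (by nlinarith [sq_nonneg x.2]) (by positivity)
    have h2 : |x.2| ≤ (r : ℤ) := abs_le_of_sq_le_sq (by nlinarith [sq_nonneg x.1]) (by positivity)
    exact ⟨⟨abs_le.1 h1, abs_le.1 h2⟩, h⟩

def isq (r : ℕ) (a : ℤ) : ℤ := (Int.sqrt ((r : ℤ) ^ 2 - a ^ 2)) + 1

def shell (r : ℕ) : Finset Site :=
  ((((Finset.Icc (-(r : ℤ)) r) ×ˢ ({1, -1} : Finset ℤ)).image fun q => ((q.1, q.2 * isq r q.1) : Site)) ∪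
    (((Finset.Icc (-(r : ℤ)) r) ×ˢ ({1, -1} : Finset ℤ)).image fun q => ((q.2 * isq r q.1, q.1) : Site)))
    \ ball r

lemma shell_card {r : ℕ} (hr : 1 ≤ r) : (shell r).card ≤ 12 * r := by
  have hc : ((Finset.Icc (-(r : ℤ)) r) ×ˢ ({1, -1} : Finset ℤ)).card ≤ (2 * r + 1) * 2 := by
    rw [Finset.card_product]
    apply Nat.mul_le_mul
    · simp; omega
    · exact Finset.card_le_two
  refine (Finset.card_le_card Finset.sdiff_subset).trans ((Finset.card_union_le _ _).trans ?_)
  have h1 := Finset.card_image_le (s := (Finset.Icc (-(r : ℤ)) r) ×ˢ ({1, -1} : Finset ℤ))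
    (f := fun q => ((q.1, q.2 * isq r q.1) : Site))
  have h2 := Finset.card_image_le (s := (Finset.Icc (-(r : ℤ)) r) ×ˢ ({1, -1} : Finset ℤ))
    (f := fun q => ((q.2 * isq r q.1, q.1) : Site))
  omega

lemma isq_abs {r : ℕ} {a b b' : ℤ} (h1 : a ^ 2 + b' ^ 2 ≤ (r : ℤ) ^ 2) (h2 : (r : ℤ) ^ 2 < a ^ 2 + b ^ 2)
    (h3 : |b - b'| = 1) : b = isq r a ∨ b = - isq r a := by
  obtain ⟨m, hm⟩ : ∃ m : ℕ, (m : ℤ) = (r : ℤ) ^ 2 - a ^ 2 :=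
    ⟨((r : ℤ) ^ 2 - a ^ 2).toNat, Int.toNat_of_nonneg (by nlinarith [sq_nonneg b'])⟩
  have hs : isq r a = (Nat.sqrt m : ℤ) + 1 := by
    unfold isq
    rw [← hm]
    simp [Int.sqrt]
  have g1 : ((Nat.sqrt m : ℤ)) * (Nat.sqrt m : ℤ) ≤ m := by exact_mod_cast Nat.sqrt_le m
  have g2 : (m : ℤ) < ((Nat.sqrt m : ℤ) + 1) * ((Nat.sqrt m : ℤ) + 1) := by
    exact_mod_cast Nat.lt_succ_sqrt m
  have g3 : |b'| ≤ Nat.sqrt m := by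
    by_contra hcon
    push Not at hcon
    have : ((Nat.sqrt m : ℤ) + 1) ≤ |b'| := hcon
    have := abs_mul_abs_self b'
    nlinarith
  have g4 : (Nat.sqrt m : ℤ) < |b| := by
    by_contra hcon
    push Not at hcon
    have := abs_mul_abs_self b
    have := abs_nonneg b
    nlinarith
  rw [hs]
  rcases abs_cases (b - b') with h | h <;> rcases abs_cases b with h' | h' <;>
    rcases abs_cases b' with h'' | h'' <;> omega

lemma mem_shell {r : ℕ} {x y : Site} (hx : x ∈ ball r) (hy : y ∉ ball r) (ha : adjP x y) :
    y ∈ shell r := by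
  unfold shell
  rw [Finset.mem_sdiff]
  refine ⟨?_, hy⟩
  rw [mem_ball] at hx hy
  push Not at hy
  obtain ⟨x1, x2⟩ := x
  obtain ⟨y1, y2⟩ := y
  simp only [adjP] at *
  have hc : (x1 = y1 ∧ |y2 - x2| = 1) ∨ (x2 = y2 ∧ |y1 - x1| = 1) := by
    rcases abs_cases (x1 - y1) with h | h <;> rcases abs_cases (x2 - y2) with h' | h' <;>
    rcases abs_cases (y1 - x1) with k | k <;> rcases abs_cases (y2 - x2) with k' | k' <;> omega
  rw [Finset.mem_union]
  rcases hc with ⟨rfl, h⟩ | ⟨rfl, h⟩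
  · left
    have h1 : |x1| ≤ (r : ℤ) := abs_le_of_sq_le_sq (by nlinarith [sq_nonneg x2]) (by positivity)
    rw [Finset.mem_image]
    rcases isq_abs hx hy h with hb | hb
    · exact ⟨(x1, 1), by simp [abs_le.1 h1], by simp [hb]⟩
    · exact ⟨(x1, -1), by simp [abs_le.1 h1], by simp [hb]⟩
  · right
    have h1 : |x2| ≤ (r : ℤ) := abs_le_of_sq_le_sq (by nlinarith [sq_nonneg x1]) (by positivity)
    rw [Finset.mem_image]
    rw [add_comm] at hx hy
    rcases isq_abs hx hy h with hb | hb
    · exact ⟨(x2, 1), by simp [abs_le.1 h1], by simp [hb]⟩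
    · exact ⟨(x2, -1), by simp [abs_le.1 h1], by simp [hb]⟩

lemma shell_far {r : ℕ} {x : Site} (hx : x ∈ shell r) : (r : ℤ) ≤ |x.1| + |x.2| := by
  have h1 := (Finset.mem_sdiff.1 hx).2
  rw [mem_ball] at h1
  push Not at h1
  by_contra hcon
  push Not at hcon
  have e1 := abs_mul_abs_self x.1
  have e2 := abs_mul_abs_self x.2
  have e3 := abs_nonneg x.1
  have e4 := abs_nonneg x.2
  nlinarith [mul_nonneg e3 e4]
lemma exp_char {c x : ℝ} (hx : x = 1 ∨ x = -1) : Real.exp (c * x) = Real.cosh c + x * Real.sinh c := by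
  rcases hx with rfl | rfl
  · rw [mul_one, one_mul, Real.cosh_add_sinh]
  · rw [mul_neg_one, neg_one_mul, ← sub_eq_add_neg, Real.cosh_sub_sinh]

lemma ising_mono {G ι : Type*} [CommGroup G] [Fintype G] (χ : ι → (G →* ℝ))
    (hχ : ∀ e g, χ e g = 1 ∨ χ e g = -1) (c c' : ι → ℝ) (s : Finset ι)
    (h : ∀ e ∈ s, |c e| ≤ c' e) : ∀ X : G →* ℝ,
    |∑ g, X g * Real.exp (∑ e ∈ s, c e * χ e g)| ≤ ∑ g, X g * Real.exp (∑ e ∈ s, c' e * χ e g) := by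
  induction s using Finset.induction_on with
  | empty =>
    intro X
    simp only [Finset.sum_empty, Real.exp_zero, mul_one]
    rw [abs_of_nonneg]
    rw [sum_hom_units]
    split_ifs <;> simp
  | insert a s ha ih =>
    intro X
    have ih' := ih fun e he => h e (Finset.mem_insert_of_mem he)
    have hexp : ∀ k : ι → ℝ, ∑ g, X g * Real.exp (∑ e ∈ insert a s, k e * χ e g) =
        Real.cosh (k a) * ∑ g, X g * Real.exp (∑ e ∈ s, k e * χ e g) +
        Real.sinh (k a) * ∑ g, (X * χ a) g * Real.exp (∑ e ∈ s, k e * χ e g) := by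
      intro k
      rw [Finset.mul_sum, Finset.mul_sum, ← Finset.sum_add_distrib]
      apply Finset.sum_congr rfl
      intro g _
      rw [Finset.sum_insert ha, Real.exp_add, exp_char (hχ a g), MonoidHom.mul_apply]
      ring
    have hca := h a (Finset.mem_insert_self _ _)
    have h1 := ih' X
    have h2 := ih' (X * χ a)
    rw [hexp c, hexp c']
    have hcosh : Real.cosh (c a) ≤ Real.cosh (c' a) := by
      rw [Real.cosh_le_cosh]
      exact hca.trans (le_abs_self _)
    have hsinh : |Real.sinh (c a)| ≤ Real.sinh (c' a) := by
      rw [Real.abs_sinh]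
      exact Real.sinh_le_sinh.2 hca
    have hc0 := (Real.cosh_pos (c a)).le
    refine (abs_add_le _ _).trans ?_
    rw [abs_mul, abs_mul, abs_of_nonneg hc0]
    apply add_le_add
    · exact mul_le_mul hcosh h1 (abs_nonneg _) (hc0.trans hcosh)
    · exact mul_le_mul hsinh h2 (abs_nonneg _) ((abs_nonneg _).trans hsinh)

abbrev Gp (B : Finset Site) : Type := {x : Site // x ∈ B} → ℤˣ

def sgn {B : Finset Site} (g : Gp B) (x : Site) : ℤ := if h : x ∈ B then ((g ⟨x, h⟩ : ℤˣ) : ℤ) else 1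

lemma sgn_mul {B : Finset Site} (g k : Gp B) (x : Site) : sgn (g * k) x = sgn g x * sgn k x := by
  unfold sgn
  split_ifs <;> simp

lemma sgn_cases {B : Finset Site} (g : Gp B) (x : Site) : sgn g x = 1 ∨ sgn g x = -1 := by
  unfold sgn
  split_ifs with h
  · rcases Int.units_eq_one_or (g ⟨x, h⟩) with h | h <;> simp [h]
  · simp

lemma sgn_sq {B : Finset Site} (g : Gp B) (x : Site) : sgn g x * sgn g x = 1 := by
  rcases sgn_cases g x with h | h <;> simp [h]

def chiE {B : Finset Site} (e : Edge) : Gp B →* ℝ where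
  toFun g := ((sgn g (src e) * sgn g (dst e) : ℤ) : ℝ)
  map_one' := by simp [sgn]
  map_mul' g k := by
    rw [sgn_mul, sgn_mul]; push_cast; ring

lemma chiE_cases {B : Finset Site} (e : Edge) (g : Gp B) : chiE e g = 1 ∨ chiE e g = -1 := by
  change ((sgn g (src e) * sgn g (dst e) : ℤ) : ℝ) = 1 ∨ ((sgn g (src e) * sgn g (dst e) : ℤ) : ℝ) = -1
  rcases sgn_cases g (src e) with h | h <;> rcases sgn_cases g (dst e) with h' | h' <;> simp [h, h']

def act {B : Finset Site} (g : Gp B) (η : Site → ℤ) : Site → ℤ := fun x => sgn g x * η x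

def Phi (β : ℝ) (B : Finset Site) (η : Site → ℤ) : ℝ := ∑ g : Gp B, Real.exp (-β * dgH (act g η))

def Psi (β : ℝ) (B : Finset Site) (η : Site → ℤ) : ℝ :=
  ∑ g : Gp B, Real.exp (∑ e ∈ edg B, (2 * β * (η (src e) * η (dst e) : ℤ)) * chiE e g)

def mm (B : Finset Site) (η : Site → ℤ) : ℝ :=
  ∑ e ∈ edg B, ((η (src e) : ℝ) ^ 2 + (η (dst e) : ℝ) ^ 2)

lemma Phi_eq (β : ℝ) {B : Finset Site} {η : Site → ℤ} (h : InD B η) :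
    Phi β B η = Real.exp (-β * mm B η) * Psi β B η := by
  unfold Phi Psi mm
  rw [Finset.mul_sum]
  apply Finset.sum_congr rfl
  intro g _
  have h2 : InD B (act g η) := fun x hx => by simp [act, h x hx]
  rw [dgH_eq h2, ← Real.exp_add, Finset.mul_sum, Finset.mul_sum, ← Finset.sum_add_distrib]
  congr 1
  apply Finset.sum_congr rfl
  intro e _
  change -β * ((sgn g (src e) * η (src e) - sgn g (dst e) * η (dst e) : ℤ) : ℝ) ^ 2 =
    _ + _ * ((sgn g (src e) * sgn g (dst e) : ℤ) : ℝ)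
  rcases sgn_cases g (src e) with h | h <;> rcases sgn_cases g (dst e) with h' | h' <;>
    rw [h, h'] <;> push_cast <;> ring

lemma Psi_mul (β : ℝ) (B : Finset Site) (a b : Site → ℤ) : Psi β B a * Psi β B b =
    ∑ t : Gp B, ∑ g : Gp B, Real.exp (∑ e ∈ edg B, (2 * β * ((a (src e) * a (dst e) : ℤ) +
      (b (src e) * b (dst e) : ℤ) * chiE e t)) * chiE e g) := by
  unfold Psi
  rw [Finset.sum_mul_sum, Finset.sum_comm]
  rw [Finset.sum_comm]
  rw [Finset.sum_comm (f := fun t g => Real.exp (∑ e ∈ edg B, (2 * β * ((a (src e) * a (dst e) : ℤ) +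
      (b (src e) * b (dst e) : ℤ) * chiE e t)) * chiE e g))]
  apply Finset.sum_congr rfl
  intro g _
  rw [← Equiv.sum_comp (Equiv.mulLeft g)]
  apply Finset.sum_congr rfl
  intro t _
  rw [← Real.exp_add, ← Finset.sum_add_distrib]
  congr 1
  apply Finset.sum_congr rfl
  intro e _
  rw [Equiv.coe_mulLeft, map_mul]
  ring

lemma coupling {a b a' b' : ℤ} (ha : 0 ≤ a) (hb : 0 ≤ b) (ha' : 0 ≤ a') (hb' : 0 ≤ b') {x : ℝ}
    (hx : x = 1 ∨ x = -1) :
    |((a * a' : ℤ) : ℝ) + (b * b' : ℤ) * x| ≤ (((a ⊔ b) * (a' ⊔ b') : ℤ) : ℝ) + ((a ⊓ b) * (a' ⊓ b') : ℤ) * x := by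
  have key : ∀ y : ℤ, (y = 1 ∨ y = -1) →
      |(a * a') + (b * b') * y| ≤ ((a ⊔ b) * (a' ⊔ b')) + ((a ⊓ b) * (a' ⊓ b')) * y := by
    intro y hy
    rw [abs_le]
    rcases le_total a b with h1 | h1 <;> rcases le_total a' b' with h2 | h2 <;>
      simp only [h1, h2, sup_of_le_left, sup_of_le_right, inf_of_le_left, inf_of_le_right] <;>
      rcases hy with rfl | rfl <;> constructor <;> nlinarith [mul_nonneg ha ha', mul_nonneg hb hb',
        mul_nonneg (sub_nonneg.2 h1) (sub_nonneg.2 h2), mul_nonneg ha hb', mul_nonneg hb ha',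
        mul_nonneg (sub_nonneg.2 h1) ha', mul_nonneg (sub_nonneg.2 h1) hb',
        mul_nonneg (sub_nonneg.2 h2) ha, mul_nonneg (sub_nonneg.2 h2) hb]
  rcases hx with rfl | rfl
  · have := key 1 (Or.inl rfl)
    exact_mod_cast this
  · have := key (-1) (Or.inr rfl)
    exact_mod_cast this

lemma Psi_supermod {β : ℝ} (hβ : 0 ≤ β) (B : Finset Site) {a b : Site → ℤ} (ha : ∀ x, 0 ≤ a x)
    (hb : ∀ x, 0 ≤ b x) : Psi β B a * Psi β B b ≤ Psi β B (a ⊓ b) * Psi β B (a ⊔ b) := by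
  rw [mul_comm (Psi β B (a ⊓ b)), Psi_mul, Psi_mul]
  apply Finset.sum_le_sum
  intro t _
  have := ising_mono (G := Gp B) (ι := Edge) (fun e => chiE e) chiE_cases
    (fun e => 2 * β * ((a (src e) * a (dst e) : ℤ) + (b (src e) * b (dst e) : ℤ) * chiE e t))
    (fun e => 2 * β * (((a ⊔ b) (src e) * (a ⊔ b) (dst e) : ℤ) +
      ((a ⊓ b) (src e) * (a ⊓ b) (dst e) : ℤ) * chiE e t)) (edg B) (by
      intro e _
      rw [abs_mul, abs_of_nonneg (by positivity : (0 : ℝ) ≤ 2 * β)]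
      apply mul_le_mul_of_nonneg_left _ (by positivity)
      exact coupling (ha _) (hb _) (ha _) (hb _) (chiE_cases e t)) 1
  simp only [MonoidHom.one_apply, one_mul] at this
  exact (le_abs_self _).trans this

lemma mm_modular (B : Finset Site) (a b : Site → ℤ) : mm B (a ⊓ b) + mm B (a ⊔ b) = mm B a + mm B b := by
  unfold mm
  rw [← Finset.sum_add_distrib, ← Finset.sum_add_distrib]
  apply Finset.sum_congr rfl
  intro e _
  simp only [Pi.inf_apply, Pi.sup_apply]
  rcases le_total (a (src e)) (b (src e)) with h1 | h1 <;>
  rcases le_total (a (dst e)) (b (dst e)) with h2 | h2 <;>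
  simp only [h1, h2, sup_of_le_left, sup_of_le_right, inf_of_le_left, inf_of_le_right] <;> ring

lemma Phi_supermod {β : ℝ} (hβ : 0 ≤ β) (B : Finset Site) {a b : Site → ℤ} (ha : ∀ x, 0 ≤ a x)
    (hb : ∀ x, 0 ≤ b x) (hA : InD B a) (hB : InD B b) :
    Phi β B a * Phi β B b ≤ Phi β B (a ⊓ b) * Phi β B (a ⊔ b) := by
  have h1 : InD B (a ⊓ b) := fun x hx => by simp [hA x hx, hB x hx]
  have h2 : InD B (a ⊔ b) := fun x hx => by simp [hA x hx, hB x hx]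
  rw [Phi_eq β hA, Phi_eq β hB, Phi_eq β h1, Phi_eq β h2]
  have := mm_modular B a b
  calc _ = Real.exp (-β * (mm B a + mm B b)) * (Psi β B a * Psi β B b) := by
        rw [mul_add, Real.exp_add]; ring
    _ ≤ Real.exp (-β * (mm B a + mm B b)) * (Psi β B (a ⊓ b) * Psi β B (a ⊔ b)) :=
        mul_le_mul_of_nonneg_left (Psi_supermod hβ B ha hb) (Real.exp_pos _).le
    _ = _ := by
        rw [← this, mul_add, Real.exp_add]; ring

lemma Phi_abs (β : ℝ) {B : Finset Site} {η : Site → ℤ} (h : InD B η) :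
    Phi β B (fun x => ((η x).natAbs : ℤ)) = Phi β B η := by
  let σ : Gp B := fun x => if η x.1 < 0 then -1 else 1
  unfold Phi
  rw [← Equiv.sum_comp (Equiv.mulRight σ)]
  apply Finset.sum_congr rfl
  intro g _
  congr 3
  funext x
  rw [Equiv.coe_mulRight, act, act, sgn_mul, mul_assoc]
  congr 1
  by_cases hx : x ∈ B
  · simp only [sgn, hx, σ, dite_true]
    split_ifs with hlt
    · simp; rw [abs_of_neg hlt]; ring
    · simp; omega
  · simp [h x hx]

lemma Phi_nonneg (β : ℝ) (B : Finset Site) (η : Site → ℤ) : 0 ≤ Phi β B η :=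
  Finset.sum_nonneg fun _ _ => (Real.exp_pos _).le

lemma symm_sum (β : ℝ) (B D : Finset Site) (E : (Site → ℤ) → Prop)
    (hE : ∀ (g : Gp B) η, E (act g η) ↔ E η) :
    ∑' η : Site → ℤ, (if InD D η ∧ E η then ENNReal.ofReal (Phi β B η) else 0) =
      (Fintype.card (Gp B) : ENNReal) * W β D E := by
  have h1 : ∀ η : Site → ℤ, (if InD D η ∧ E η then ENNReal.ofReal (Phi β B η) else 0) =
      ∑ g : Gp B, (if InD D (act g η) ∧ E (act g η) then wt β (act g η) else 0) := by
    intro η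
    have hI : ∀ g : Gp B, InD D (act g η) ↔ InD D η := by
      intro g
      have hne : ∀ x, sgn g x ≠ 0 := fun x => by rcases sgn_cases g x with h | h <;> simp [h]
      simp [InD, act, hne]
    by_cases hc : InD D η ∧ E η
    · rw [if_pos hc, Phi, ENNReal.ofReal_sum_of_nonneg (fun _ _ => (Real.exp_pos _).le)]
      apply Finset.sum_congr rfl
      intro g _
      rw [if_pos ⟨(hI g).2 hc.1, (hE g η).2 hc.2⟩, wt]
    · rw [if_neg hc]
      symm
      apply Finset.sum_eq_zero
      intro g _
      rw [if_neg]
      rw [hI, hE]; exact hc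
  simp_rw [h1]
  rw [Summable.tsum_finsetSum (fun _ _ => ENNReal.summable)]
  have h2 : ∀ g : Gp B, ∑' η : Site → ℤ, (if InD D (act g η) ∧ E (act g η) then wt β (act g η) else 0)
      = W β D E := by
    intro g
    have hinv : Function.Involutive (act g) := by
      intro η
      funext x
      simp only [act, ← mul_assoc, sgn_sq, one_mul]
    exact (hinv.toPerm).tsum_eq (fun η => if InD D η ∧ E η then wt β η else 0)
  simp_rw [h2]
  rw [Finset.sum_const, Finset.card_univ, nsmul_eq_mul]

def dc (k : Site → ℕ) : Site → ℤ := fun x => Equiv.intEquivNat.symm (k x)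

lemma natAbs_dc (n : ℕ) : (Equiv.intEquivNat.symm n).natAbs = (n + 1) / 2 := by
  obtain ⟨m, rfl⟩ := Equiv.intEquivNat.surjective n
  rw [Equiv.symm_apply_apply]
  cases m with
  | ofNat m =>
    have : Equiv.intEquivNat (Int.ofNat m) = 2 * m := rfl
    rw [this]; simp; omega
  | negSucc m =>
    have : Equiv.intEquivNat (Int.negSucc m) = 2 * m + 1 := rfl
    rw [this]; simp; omega

lemma dc_zero (n : ℕ) : Equiv.intEquivNat.symm n = 0 ↔ n = 0 := by
  rw [← Int.natAbs_eq_zero, natAbs_dc]; omega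

lemma InD_dc {D : Finset Site} {k : Site → ℕ} : InD D (dc k) ↔ ∀ x ∉ D, k x = 0 := by
  simp [InD, dc, dc_zero]

lemma tsum_dc (f : (Site → ℤ) → ENNReal) : ∑' k, f (dc k) = ∑' η, f η :=
  (Equiv.piCongrRight fun _ : Site => Equiv.intEquivNat.symm).tsum_eq f

lemma fkg_main {β : ℝ} (hβ : 0 ≤ β) {D B : Finset Site} (hDB : D ⊆ B) (h : ℕ) (p : Site) :
    W β D (fun η => h ≤ (η p).natAbs) * W β B (fun _ => True) ≤
      W β D (fun _ => True) * W β B (fun η => h ≤ (η p).natAbs) := by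
  let N : (Site → ℕ) → Site → ℤ := fun k x => ((dc k x).natAbs : ℤ)
  let F : Finset Site → ((Site → ℤ) → Prop) → (Site → ℕ) → ℝ := fun D E k =>
    if InD D (dc k) ∧ E (dc k) then Phi β B (dc k) else 0
  let E1 : (Site → ℤ) → Prop := fun η => h ≤ (η p).natAbs
  let ET : (Site → ℤ) → Prop := fun _ => True
  have hF0 : ∀ D E k, 0 ≤ F D E k := by
    intro D E k
    simp only [F]
    split_ifs
    · exact Phi_nonneg _ _ _
    · exact le_rfl
  have hN : ∀ k x, N k x = (((k x + 1) / 2 : ℕ) : ℤ) := fun k x => by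
    simp only [N, dc, natAbs_dc]
  have hNinf : ∀ k l, N (k ⊓ l) = N k ⊓ N l := by
    intro k l; funext x
    simp only [hN, Pi.inf_apply]
    rcases le_total (k x) (l x) with h | h <;> simp only [h, inf_of_le_left, inf_of_le_right]
    · rw [inf_of_le_left]; exact_mod_cast (by omega)
    · rw [inf_of_le_right]; exact_mod_cast (by omega)
  have hNsup : ∀ k l, N (k ⊔ l) = N k ⊔ N l := by
    intro k l; funext x
    simp only [hN, Pi.sup_apply]
    rcases le_total (k x) (l x) with h | h <;> simp only [h, sup_of_le_left, sup_of_le_right]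
    · rw [sup_of_le_right]; exact_mod_cast (by omega)
    · rw [sup_of_le_left]; exact_mod_cast (by omega)
  have hfour : ∀ k l, F D E1 k * F B ET l ≤ F D ET (k ⊓ l) * F B E1 (k ⊔ l) := by
    intro k l
    by_cases h1 : InD D (dc k) ∧ E1 (dc k)
    · by_cases h2 : InD B (dc l)
      · have hk := InD_dc.1 h1.1
        have hl := InD_dc.1 h2
        have h3 : InD D (dc (k ⊓ l)) := InD_dc.2 fun x hx => by simp [hk x hx]
        have h4 : InD B (dc (k ⊔ l)) := InD_dc.2 fun x hx => by
          simp [hk x (fun h => hx (hDB h)), hl x hx]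
        have h5 : E1 (dc (k ⊔ l)) := by
          have e1 : h ≤ (dc k p).natAbs := h1.2
          change h ≤ (dc (k ⊔ l) p).natAbs
          simp only [dc, natAbs_dc] at e1 ⊢
          have : k p ≤ (k ⊔ l) p := le_sup_left
          omega
        have h6 : InD B (dc k) := h1.1.mono hDB
        simp only [F]
        rw [if_pos h1, if_pos ⟨h2, trivial⟩, if_pos ⟨h3, trivial⟩, if_pos ⟨h4, h5⟩,
          ← Phi_abs β h6, ← Phi_abs β h2, ← Phi_abs β (h3.mono hDB), ← Phi_abs β h4]
        have := Phi_supermod hβ B (a := N k) (b := N l) (fun x => by simp [N]) (fun x => by simp [N])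
          (fun x hx => by simp [N, h6 x hx]) (fun x hx => by simp [N, h2 x hx])
        rw [← hNinf, ← hNsup] at this
        exact this
      · have : F B ET l = 0 := if_neg fun h => h2 h.1
        rw [this, mul_zero]
        exact mul_nonneg (hF0 D ET (k ⊓ l)) (hF0 B E1 (k ⊔ l))
    · have : F D E1 k = 0 := if_neg h1
      rw [this, zero_mul]
      exact mul_nonneg (hF0 D ET (k ⊓ l)) (hF0 B E1 (k ⊔ l))
  have hT : ∀ D E, (∀ (g : Gp B) η, E (act g η) ↔ E η) →
      ∑' k, ENNReal.ofReal (F D E k) = (Fintype.card (Gp B) : ENNReal) * W β D E := by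
    intro D E hE
    rw [← symm_sum β B D E hE, ← tsum_dc]
    apply tsum_congr
    intro k
    simp only [F]
    split_ifs <;> simp
  have hE1 : ∀ (g : Gp B) η, E1 (act g η) ↔ E1 η := by
    intro g η
    simp only [E1, act, Int.natAbs_mul]
    rcases sgn_cases g p with h | h <;> simp [h]
  have hprod : (∑' k, ENNReal.ofReal (F D E1 k)) * (∑' k, ENNReal.ofReal (F B ET k)) ≤
      (∑' k, ENNReal.ofReal (F D ET k)) * (∑' k, ENNReal.ofReal (F B E1 k)) := by
    rw [ENNReal.tsum_eq_iSup_sum (f := fun k => ENNReal.ofReal (F D E1 k)),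
      ENNReal.tsum_eq_iSup_sum (f := fun k => ENNReal.ofReal (F B ET k)), ENNReal.iSup_mul]
    apply iSup_le
    intro s
    rw [ENNReal.mul_iSup]
    apply iSup_le
    intro t
    have h4 := four_functions_theorem (F D E1) (F B ET) (F D ET) (F B E1)
      (hF0 D E1) (hF0 B ET) (hF0 D ET) (hF0 B E1) hfour s t
    have h5 := ENNReal.ofReal_le_ofReal h4
    rw [ENNReal.ofReal_mul (Finset.sum_nonneg fun i _ => hF0 D E1 i),
      ENNReal.ofReal_mul (Finset.sum_nonneg fun i _ => hF0 D ET i),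
      ENNReal.ofReal_sum_of_nonneg (fun i _ => hF0 D E1 i),
      ENNReal.ofReal_sum_of_nonneg (fun i _ => hF0 B ET i),
      ENNReal.ofReal_sum_of_nonneg (fun i _ => hF0 D ET i),
      ENNReal.ofReal_sum_of_nonneg (fun i _ => hF0 B E1 i)] at h5
    refine h5.trans (mul_le_mul' (ENNReal.sum_le_tsum _) (ENNReal.sum_le_tsum _))
  rw [hT D E1 hE1, hT B E1 hE1, hT D ET (fun _ _ => Iff.rfl), hT B ET (fun _ _ => Iff.rfl)] at hprod
  have hc0 : (Fintype.card (Gp B) : ENNReal) ≠ 0 := by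
    exact_mod_cast Fintype.card_ne_zero
  have hct : (Fintype.card (Gp B) : ENNReal) ≠ ⊤ := ENNReal.natCast_ne_top _
  rw [mul_mul_mul_comm, mul_mul_mul_comm _ (W β D ET)] at hprod
  exact (ENNReal.mul_le_mul_iff_right (mul_ne_zero hc0 hc0) (ENNReal.mul_ne_top hct hct)).1 hprod

lemma W_abs (β : ℝ) (D : Finset Site) {h : ℕ} (hh : 1 ≤ h) (p : Site) :
    W β D (fun η => h ≤ (η p).natAbs) = 2 * W β D (fun η => (h : ℤ) ≤ η p) := by
  rw [two_mul]
  nth_rewrite 2 [← W_neg]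
  unfold W
  rw [← ENNReal.tsum_add]
  apply tsum_congr
  intro η
  simp only [Pi.neg_apply]
  by_cases hI : InD D η
  · simp only [hI, true_and]
    rcases lt_trichotomy (η p) 0 with h0 | h0 | h0
    · have e1 : ¬ ((h : ℤ) ≤ η p) := by omega
      have e2 : h ≤ (η p).natAbs ↔ (h : ℤ) ≤ - η p := by omega
      simp [e1, e2]
    · have e1 : ¬ ((h : ℤ) ≤ η p) := by omega
      have e2 : h ≤ (η p).natAbs ↔ (h : ℤ) ≤ - η p := by omega
      simp [e1, e2]
    · have e1 : ¬ ((h : ℤ) ≤ - η p) := by omega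
      have e2 : h ≤ (η p).natAbs ↔ (h : ℤ) ≤ η p := by omega
      simp [e1, e2]
  · simp [hI]

lemma fkg_ge {β : ℝ} (hβ : 0 ≤ β) {D B : Finset Site} (hDB : D ⊆ B) {h : ℕ} (hh : 1 ≤ h) (p : Site) :
    W β D (fun η => (h : ℤ) ≤ η p) * W β B (fun _ => True) ≤
      W β D (fun _ => True) * W β B (fun η => (h : ℤ) ≤ η p) := by
  have := fkg_main hβ hDB h p
  rw [W_abs β D hh, W_abs β B hh] at this
  have h2 : 2 * (W β D (fun η => (h : ℤ) ≤ η p) * W β B (fun _ => True)) ≤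
      2 * (W β D (fun _ => True) * W β B (fun η => (h : ℤ) ≤ η p)) := by
    convert this using 1 <;> ring
  exact (ENNReal.mul_le_mul_iff_right (a := 2) (by simp) (by simp)).1 h2
lemma W_split (β : ℝ) (D : Finset Site) (E P : (Site → ℤ) → Prop) :
    W β D E ≤ W β D (fun η => E η ∧ ¬ P η) + W β D (fun η => E η ∧ P η) := by
  unfold W
  rw [← ENNReal.tsum_add]
  apply ENNReal.tsum_le_tsum
  intro η
  by_cases h1 : InD D η <;> by_cases h2 : E η <;> by_cases h3 : P η <;> simp [h1, h2, h3]

lemma second_term {β : ℝ} (hβ0 : 0 < β) (hβ : Real.exp (-β / 2) ≤ 1 / 256)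
    (hδ : 1024 * Real.exp (-β) < 1) (V : Finset Site) {h : ℕ} (hh : 1 ≤ h) {r : ℕ} (hr : 1 ≤ r) :
    W β V (fun η => η (0, 0) = (h : ℤ) ∧ Sepp (shell r) η) * W β (ball r) (fun _ => True) ≤
      ENNReal.ofReal (1 / (1 - 1024 * Real.exp (-β))) ^ (13 * r) *
        (W β (ball r) (fun η => η (0, 0) = (h : ℤ)) * W β V (fun _ => True)) := by
  have hhz : (1 : ℤ) ≤ (h : ℤ) := by exact_mod_cast hh
  have he := Real.exp_pos (-β)
  set c := ENNReal.ofReal (1 / (1 - 1024 * Real.exp (-β))) with hc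
  have hc1 : 1 ≤ c := by
    rw [hc, ENNReal.one_le_ofReal, le_div_iff₀ (by linarith)]
    linarith
  let D1 : Finset Site := V.filter (fun x => x ∈ ball r)
  let D2 : Finset Site := (V \ shell r).filter (fun x => x ∉ ball r)
  have hdisj : ∀ x ∈ ball r, x ∉ shell r := by
    intro x hx hs
    exact (Finset.mem_sdiff.1 hs).2 hx
  have hU : V \ shell r = D1 ∪ D2 := by
    ext x
    simp only [D1, D2, Finset.mem_union, Finset.mem_filter, Finset.mem_sdiff]
    have := hdisj x
    tauto
  have hd : ∀ x ∈ D1, x ∉ D2 := by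
    intro x hx hx2
    exact (Finset.mem_filter.1 hx2).2 (Finset.mem_filter.1 hx).2
  have hadj : ∀ x ∈ D1, ∀ y ∈ D2, ¬ adjP x y := by
    intro x hx y hy ha
    have hy' := Finset.mem_filter.1 hy
    exact (Finset.mem_sdiff.1 hy'.1).2 (mem_shell (Finset.mem_filter.1 hx).2 hy'.2 ha)
  have hp : ((0, 0) : Site) ∉ D2 := by
    intro hy
    apply (Finset.mem_filter.1 hy).2
    rw [mem_ball]
    positivity
  have hD1 : D1 ⊆ ball r := fun x hx => (Finset.mem_filter.1 hx).2
  have e1 := chain hβ0 hβ hδ V (shell r) hhz (shell r) (Finset.Subset.refl _)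
  have e2 : W β (V \ shell r) (fun η => η (0, 0) = (h : ℤ) ∧ Sepp (shell r) η) ≤
      W β D1 (fun η => (h : ℤ) ≤ η (0, 0)) * W β D2 (fun _ => True) := by
    rw [hU, ← W_factor β hd hadj hp (fun n => (h : ℤ) ≤ n)]
    exact W_mono fun η _ hη => hη.1.ge
  have e3 : W β D1 (fun _ => True) * W β D2 (fun _ => True) ≤ W β V (fun _ => True) := by
    rw [← W_factor β hd hadj hp (fun _ => True), ← hU]
    exact W_mono_D Finset.sdiff_subset _
  have e4 := fkg_ge hβ0.le hD1 hh ((0, 0) : Site)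
  have e5 : W β (ball r) (fun η => (h : ℤ) ≤ η (0, 0)) ≤ c * W β (ball r) (fun η => η (0, 0) = (h : ℤ)) := by
    have := ennreal_absorb (W_ne_top hβ0 _ _) (W_ne_top hβ0 _ _) (by positivity) (by linarith)
      (ge_step hβ0.le hβ (ball r) hhz)
    refine this.trans (mul_le_mul_left ?_ _)
    apply ENNReal.ofReal_le_ofReal
    apply one_div_le_one_div_of_le <;> linarith
  calc _ ≤ (c ^ (shell r).card * (W β D1 (fun η => (h : ℤ) ≤ η (0, 0)) * W β D2 (fun _ => True))) *
        W β (ball r) (fun _ => True) := by gcongr; exact e1.trans (by gcongr)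
    _ = c ^ (shell r).card * ((W β D1 (fun η => (h : ℤ) ≤ η (0, 0)) * W β (ball r) (fun _ => True)) *
        W β D2 (fun _ => True)) := by ring
    _ ≤ c ^ (12 * r) * ((W β D1 (fun _ => True) * (c * W β (ball r) (fun η => η (0, 0) = (h : ℤ)))) *
        W β D2 (fun _ => True)) := by
        exact mul_le_mul' (pow_le_pow_right₀ hc1 (shell_card hr))
          (mul_le_mul' (e4.trans (mul_le_mul' le_rfl e5)) le_rfl)
    _ = c ^ (12 * r + 1) * (W β (ball r) (fun η => η (0, 0) = (h : ℤ)) *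
        (W β D1 (fun _ => True) * W β D2 (fun _ => True))) := by ring
    _ ≤ _ := by
        exact mul_le_mul' (pow_le_pow_right₀ hc1 (by omega)) (mul_le_mul' le_rfl e3)

lemma exp_small {x : ℝ} (hx : 10 ≤ x) : Real.exp (-x) < 1 / 1024 := by
  have h1 : (2 : ℝ) ^ 10 < Real.exp 1 ^ 10 := by
    gcongr
    have := Real.exp_one_gt_d9
    linarith
  have h2 : Real.exp 1 ^ 10 = Real.exp 10 := by
    rw [← Real.exp_nat_mul]; norm_num
  have h3 : Real.exp 10 ≤ Real.exp x := Real.exp_le_exp.2 hx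
  rw [Real.exp_neg, inv_eq_one_div]
  apply one_div_lt_one_div_of_lt (by norm_num)
  rw [h2] at h1
  norm_num at h1
  linarith

def epsF (β : ℝ) : ℝ := -13 * Real.log (1 - 1024 * Real.exp (-β))

lemma epsF_tendsto : Tendsto epsF atTop (𝓝 0) := by
  have h1 : Tendsto (fun β : ℝ => 1 - 1024 * Real.exp (-β)) atTop (𝓝 (1 - 1024 * 0)) :=
    tendsto_const_nhds.sub (Real.tendsto_exp_neg_atTop_nhds_zero.const_mul _)
  have h2 := (h1.log (by norm_num)).const_mul (-13)
  have h3 : epsF = fun β => -13 * Real.log (1 - 1024 * Real.exp (-β)) := rfl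
  rw [h3]
  simpa using h2

lemma epsF_exp {β : ℝ} (hδ : 1024 * Real.exp (-β) < 1) (r : ℕ) :
    Real.exp (epsF β * r) = (1 / (1 - 1024 * Real.exp (-β))) ^ (13 * r) := by
  have hp : 0 < 1 - 1024 * Real.exp (-β) := by linarith
  have : epsF β * r = ((13 * r : ℕ) : ℝ) * Real.log (1 / (1 - 1024 * Real.exp (-β))) := by
    rw [one_div, Real.log_inv, epsF]; push_cast; ring
  rw [this, Real.exp_nat_mul, Real.exp_log (by positivity)]

/-- **Lemma 2.4.** `π_V(η_0 = h) ≤ e^{−(3/4)βr} π_V(η_0 = h−1) + e^{ε(β) r} π_{B_r}(η_0 = h)`. -/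
theorem dg_reduction_to_ball :
    ∃ β₀ > (0 : ℝ), ∃ ε : ℝ → ℝ, Tendsto ε atTop (𝓝 0) ∧
      ∀ β ≥ β₀, ∀ V : Finset Site, (0, 0) ∈ V → ∀ h : ℕ, 1 ≤ h → ∀ r : ℕ, 1 ≤ r →
        dgProb β V (fun η => η (0, 0) = (h : ℤ)) ≤
          Real.exp (-(3 / 4) * β * (r : ℝ)) * dgProb β V (fun η => η (0, 0) = (h : ℤ) - 1) +
            Real.exp (ε β * (r : ℝ)) * dgProb β (ball r) (fun η => η (0, 0) = (h : ℤ)) := by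
  refine ⟨100, by norm_num, epsF, epsF_tendsto, ?_⟩
  intro β hβ V _ h hh r hr
  have hβ0 : 0 < β := by linarith
  have hhz : (1 : ℤ) ≤ (h : ℤ) := by exact_mod_cast hh
  have hb8 : Real.exp (-β / 8) ≤ 1 / 256 := by
    have := exp_small (x := β / 8) (by linarith)
    rw [neg_div]; linarith
  have hb2 : Real.exp (-β / 2) ≤ 1 / 256 := by
    have := exp_small (x := β / 2) (by linarith)
    rw [neg_div]; linarith
  have hδ : 1024 * Real.exp (-β) < 1 := by
    have := exp_small (x := β) (by linarith)
    linarith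
  have t1 := first_term hβ0.le hb8 V (shell r) r (fun s hs => shell_far hs) hhz
  have t2 := second_term hβ0 hb2 hδ V hh hr
  have t0 := W_split β V (fun η => η (0, 0) = (h : ℤ)) (Sepp (shell r))
  have hN := fun D E => W_ne_top hβ0 D E
  have hZ : ∀ D, 0 < (W β D (fun _ => True)).toReal := fun D =>
    ENNReal.toReal_pos (Z_ne_zero β D) (hN _ _)
  have t0' := ENNReal.toReal_mono (by simp [hN]) t0
  have t1' := ENNReal.toReal_mono (ENNReal.mul_ne_top ENNReal.ofReal_ne_top (hN _ _)) t1
  have t2' := ENNReal.toReal_mono (ENNReal.mul_ne_top (ENNReal.pow_ne_top ENNReal.ofReal_ne_top)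
    (ENNReal.mul_ne_top (hN _ _) (hN _ _))) t2
  rw [ENNReal.toReal_add (hN _ _) (hN _ _)] at t0'
  rw [ENNReal.toReal_mul, ENNReal.toReal_ofReal (Real.exp_pos _).le] at t1'
  have hp : 0 < 1 - 1024 * Real.exp (-β) := by linarith
  rw [ENNReal.toReal_mul, ENNReal.toReal_mul, ENNReal.toReal_mul, ENNReal.toReal_pow,
    ENNReal.toReal_ofReal (by positivity), ← epsF_exp hδ] at t2'
  simp only [dgProb, dgW_eq]
  have hV := hZ V
  have hB := hZ (ball r)
  rw [div_le_iff₀ hV, add_mul]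
  have t3 : (W β V (fun η => η (0, 0) = (h : ℤ) ∧ Sepp (shell r) η)).toReal ≤
      Real.exp (epsF β * r) * ((W β (ball r) (fun η => η (0, 0) = (h : ℤ))).toReal /
        (W β (ball r) (fun _ => True)).toReal) * (W β V (fun _ => True)).toReal := by
    rw [← le_div_iff₀ hB] at t2'
    refine t2'.trans (le_of_eq ?_)
    field_simp
  have t4 : Real.exp (-(3 / 4) * β * r) * ((W β V (fun η => η (0, 0) = (h : ℤ) - 1)).toReal /
      (W β V (fun _ => True)).toReal) * (W β V (fun _ => True)).toReal =
      Real.exp (-(3 / 4) * β * r) * (W β V (fun η => η (0, 0) = (h : ℤ) - 1)).toReal := by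
    field_simp
  rw [t4]
  linarith
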